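/- arXiv:2403.05254 — 9 statements merged into one kernel-verified Lean document; each statement's English description precedes it below -/
import Mathlib

section
/- Let G be a finite simple graph with at least one edge. Then there exists a mitigating set S ⊆ E(G) with |S| = es_Δ(G) such that every connected component of the subgraph of G induced by the edge set S is a path on 2 vertices or a path on 3 vertices. -/
open SimpleGraph

attribute [local instance] Classical.propDecidable

universe u

variable {V : Type u}

/-- A set of edges of `G` is *mitigating* if its removal decreases the maximum degree
of `G` by exactly one. -/
def SimpleGraph.IsMitigating [Fintype V] (G : SimpleGraph V) (S : Set (Sym2 V)) : Prop :=
  S ⊆ G.edgeSet ∧ (G.deleteEdges S).maxDegree = G.maxDegree - 1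

/-- The Δ-edge stability number `es_Δ(G)`: the minimum cardinality of a mitigating set. -/
noncomputable def SimpleGraph.esDelta [Fintype V] (G : SimpleGraph V) : ℕ :=
  sInf {n | ∃ S : Set (Sym2 V), G.IsMitigating S ∧ S.ncard = n}

namespace SimpleGraph

/-- `F` is a matching of `G` all of whose edges join vertices of `M`. -/
structure IsMatchingOn (G : SimpleGraph V) (M : Finset V) (F : Finset (Sym2 V)) : Prop where
  mem_edgeSet : ∀ e ∈ F, e ∈ G.edgeSet
  mem_of_mem : ∀ e ∈ F, ∀ v ∈ e, v ∈ M
  eq_of_mem : ∀ e ∈ F, ∀ e' ∈ F, ∀ v, v ∈ e → v ∈ e' → e = e'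

/-- The vertices of `M` that no edge of `F` covers. -/
noncomputable def exposed (M : Finset V) (F : Finset (Sym2 V)) : Finset V :=
  M.filter fun v => ∀ e ∈ F, v ∉ e

lemma mem_exposed {M : Finset V} {F : Finset (Sym2 V)} {v : V} :
    v ∈ exposed M F ↔ v ∈ M ∧ ∀ e ∈ F, v ∉ e := by
  simp [exposed]

namespace IsMatchingOn

variable {G : SimpleGraph V} {M : Finset V} {F : Finset (Sym2 V)}

lemma card_exposed (hF : G.IsMatchingOn M F) : (exposed M F).card + 2 * F.card = M.card := by
  have hcov : (F.biUnion Sym2.toFinset).card = F.card * 2 := by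
    rw [Finset.card_biUnion, Finset.sum_const_nat]
    · intro e he
      exact Sym2.card_toFinset_of_not_isDiag e (G.not_isDiag_of_mem_edgeSet (hF.mem_edgeSet e he))
    · intro e he e' he' hne
      refine Finset.disjoint_left.2 fun v hv hv' => hne ?_
      exact hF.eq_of_mem e he e' he' v (Sym2.mem_toFinset.1 hv) (Sym2.mem_toFinset.1 hv')
  have heq : exposed M F = M \ F.biUnion Sym2.toFinset := by
    ext v
    simp [mem_exposed]
  have hsub : F.biUnion Sym2.toFinset ⊆ M := by
    intro v hv
    obtain ⟨e, he, hve⟩ := Finset.mem_biUnion.1 hv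
    exact hF.mem_of_mem e he v (Sym2.mem_toFinset.1 hve)
  have := Finset.card_sdiff_add_card_eq_card hsub
  rw [heq]
  omega

lemma insert_edge (hF : G.IsMatchingOn M F) {v w : V} (hv : v ∈ exposed M F)
    (hw : w ∈ exposed M F) (h : G.Adj v w) : G.IsMatchingOn M (insert s(v, w) F) := by
  rw [mem_exposed] at hv hw
  refine ⟨?_, ?_, ?_⟩
  · intro e he
    rcases Finset.mem_insert.1 he with rfl | he
    · exact h
    · exact hF.mem_edgeSet e he
  · intro e he x hx
    rcases Finset.mem_insert.1 he with rfl | he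
    · rcases Sym2.mem_iff.1 hx with rfl | rfl
      exacts [hv.1, hw.1]
    · exact hF.mem_of_mem e he x hx
  · intro e he e' he' x hx hx'
    rcases Finset.mem_insert.1 he with rfl | h₁ <;> rcases Finset.mem_insert.1 he' with rfl | h₂
    · rfl
    · rcases Sym2.mem_iff.1 hx with rfl | rfl
      exacts [absurd hx' (hv.2 _ h₂), absurd hx' (hw.2 _ h₂)]
    · rcases Sym2.mem_iff.1 hx' with rfl | rfl
      exacts [absurd hx (hv.2 _ h₁), absurd hx (hw.2 _ h₁)]
    · exact hF.eq_of_mem e h₁ e' h₂ x hx hx'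

lemma erase (hF : G.IsMatchingOn M F) (e : Sym2 V) : G.IsMatchingOn M (F.erase e) :=
  ⟨fun _ h => hF.mem_edgeSet _ (Finset.mem_of_mem_erase h),
    fun _ h => hF.mem_of_mem _ (Finset.mem_of_mem_erase h),
    fun _ h _ h' => hF.eq_of_mem _ (Finset.mem_of_mem_erase h) _ (Finset.mem_of_mem_erase h')⟩

end IsMatchingOn

lemma card_insert_of_mem_exposed {M : Finset V} {F : Finset (Sym2 V)} {v : V}
    (hv : v ∈ exposed M F) (w : V) : (insert s(v, w) F).card = F.card + 1 :=
  Finset.card_insert_of_notMem fun h => (mem_exposed.1 hv).2 _ h (Sym2.mem_mk_left v w)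

lemma isMatchingOn_empty (G : SimpleGraph V) (M : Finset V) : G.IsMatchingOn M ∅ := by
  constructor <;> simp

/-- Every set of edges covering `M` contains a matching that accounts for its savings. -/
lemma exists_isMatchingOn_card_le (G : SimpleGraph V) (M : Finset V) (S : Finset (Sym2 V))
    (hS : ∀ e ∈ S, e ∈ G.edgeSet) (hcov : ∀ v ∈ M, ∃ e ∈ S, v ∈ e) :
    ∃ F, G.IsMatchingOn M F ∧ M.card ≤ S.card + F.card := by
  obtain ⟨F, hFmem, hmax⟩ := Finset.exists_max_image
    (S.powerset.filter fun F => G.IsMatchingOn M F) Finset.card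
    ⟨∅, by simp [isMatchingOn_empty]⟩
  simp only [Finset.mem_filter, Finset.mem_powerset] at hFmem hmax
  obtain ⟨hFS, hF⟩ := hFmem
  refine ⟨F, hF, ?_⟩
  have hcov' : ∀ v, ∃ e, v ∈ M → e ∈ S ∧ v ∈ e := by
    intro v
    by_cases hv : v ∈ M
    · obtain ⟨e, he⟩ := hcov v hv
      exact ⟨e, fun _ => he⟩
    · exact ⟨s(v, v), fun h => absurd h hv⟩
  choose g hg using hcov'
  have hgS : ∀ v ∈ M, g v ∈ S := fun v hv => (hg v hv).1
  replace hg : ∀ v ∈ M, v ∈ g v := fun v hv => (hg v hv).2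
  have hmaps : ∀ v ∈ exposed M F, g v ∈ S \ F := by
    intro v hv
    rw [mem_exposed] at hv
    exact Finset.mem_sdiff.2 ⟨hgS v hv.1, fun h => hv.2 _ h (hg v hv.1)⟩
  have hinj : Set.InjOn g (exposed M F) := by
    intro v hv w hw hvw
    by_contra hne
    have hv' := (mem_exposed.1 hv).1
    have hw' := (mem_exposed.1 hw).1
    have he : g v = s(v, w) := (Sym2.mem_and_mem_iff hne).1 ⟨hg v hv', hvw ▸ hg w hw'⟩
    have hadj : G.Adj v w := by
      have := hS _ (hgS v hv')
      rwa [he] at this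
    have h := hmax (insert s(v, w) F)
      ⟨Finset.insert_subset (he ▸ hgS v hv') hFS, hF.insert_edge hv hw hadj⟩
    rw [card_insert_of_mem_exposed hv] at h
    omega
  have h₁ := Finset.card_le_card_of_injOn g hmaps hinj
  have h₂ := Finset.card_sdiff_add_card_eq_card hFS
  have h₃ := hF.card_exposed
  omega

/-- The vertices of maximum degree can be mapped injectively to neighbours. -/
lemma exists_injOn_adj_of_degree_eq_maxDegree [Fintype V] (G : SimpleGraph V)
    (hpos : 0 < G.maxDegree) :
    ∃ f : V → V, Set.InjOn f {v | G.degree v = G.maxDegree} ∧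
      ∀ v, G.degree v = G.maxDegree → G.Adj v (f v) := by
  have key := (Finset.all_card_le_biUnion_card_iff_exists_injective
    (fun v : {v // G.degree v = G.maxDegree} => G.neighborFinset v)).1 (by
      intro s
      refine Nat.le_of_mul_le_mul_right
        (Finset.card_mul_le_card_mul (fun (v : {v // G.degree v = G.maxDegree}) w => G.Adj v w)
          (m := G.maxDegree) (n := G.maxDegree) ?_ ?_) hpos
      · intro v hv
        refine le_trans (v.2.symm.trans (G.card_neighborFinset_eq_degree v).symm).le ?_
        refine Finset.card_le_card fun w hw => ?_
        refine Finset.mem_filter.2 ⟨Finset.mem_biUnion.2 ⟨v, hv, hw⟩, ?_⟩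
        simpa using hw
      · intro w _
        refine le_trans ?_ (G.degree_le_maxDegree w)
        rw [← card_neighborFinset_eq_degree]
        refine Finset.card_le_card_of_injOn (fun v => v.1) ?_ Subtype.val_injective.injOn
        intro v hv
        have := (Finset.mem_filter.1 hv).2
        simpa using this.symm)
  obtain ⟨f, hf, hfa⟩ := key
  refine ⟨fun v => if h : G.degree v = G.maxDegree then f ⟨v, h⟩ else v, ?_, ?_⟩
  · intro v hv w hw h
    simp only [Set.mem_ofPred_eq] at hv hw
    simp only [hv, hw, dif_pos] at h
    exact congrArg Subtype.val (hf h)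
  · intro v hv
    simp only [hv, dif_pos]
    simpa using hfa ⟨v, hv⟩

lemma IsMitigating.exists_mem [Fintype V] {G : SimpleGraph V} {S : Set (Sym2 V)}
    (hS : G.IsMitigating S) (hpos : 0 < G.maxDegree) {v : V} (hv : G.degree v = G.maxDegree) :
    ∃ e ∈ S, v ∈ e := by
  by_contra! h
  have h₁ := (G.deleteEdges S).degree_le_maxDegree v
  rw [hS.2] at h₁
  have h₂ : G.degree v ≤ (G.deleteEdges S).degree v := by
    rw [← card_neighborFinset_eq_degree, ← card_neighborFinset_eq_degree]
    refine Finset.card_le_card fun w hw => ?_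
    simp only [mem_neighborFinset, deleteEdges_adj] at hw ⊢
    exact ⟨hw, fun h' => h _ h' (Sym2.mem_mk_left v w)⟩
  omega

lemma isMitigating_of_forall_exists_mem [Fintype V] {G : SimpleGraph V} {S : Set (Sym2 V)}
    (hS : S ⊆ G.edgeSet) (hcov : ∀ v, G.degree v = G.maxDegree → ∃ e ∈ S, v ∈ e)
    {v w : V} (hv : G.degree v = G.maxDegree) (hvw : ∀ x, s(v, x) ∈ S → x = w) :
    G.IsMitigating S := by
  refine ⟨hS, le_antisymm ?_ ?_⟩
  · refine maxDegree_le_of_forall_degree_le _ _ fun x => ?_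
    have hsub : (G.deleteEdges S).neighborFinset x ⊆ G.neighborFinset x := by
      intro y hy
      simp only [mem_neighborFinset, deleteEdges_adj] at hy ⊢
      exact hy.1
    by_cases hx : G.degree x = G.maxDegree
    · obtain ⟨e, he, hxe⟩ := hcov x hx
      obtain ⟨y, rfl⟩ := Sym2.mem_iff_exists.1 hxe
      have : (G.deleteEdges S).neighborFinset x ⊂ G.neighborFinset x := by
        refine Finset.ssubset_iff_subset_ne.2 ⟨hsub, fun h => ?_⟩
        have hy : y ∈ G.neighborFinset x := by simpa using hS he
        rw [← h] at hy
        simp only [mem_neighborFinset, deleteEdges_adj] at hy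
        exact hy.2 he
      have := Finset.card_lt_card this
      simp only [card_neighborFinset_eq_degree] at this
      omega
    · have h₁ := Finset.card_le_card hsub
      have h₂ := G.degree_le_maxDegree x
      simp only [card_neighborFinset_eq_degree] at h₁
      omega
  · refine le_trans ?_ ((G.deleteEdges S).degree_le_maxDegree v)
    have hsub : G.neighborFinset v ⊆ insert w ((G.deleteEdges S).neighborFinset v) := by
      intro x hx
      simp only [Finset.mem_insert, mem_neighborFinset, deleteEdges_adj] at hx ⊢
      by_cases h : s(v, x) ∈ S
      · exact Or.inl (hvw x h)
      · exact Or.inr ⟨hx, h⟩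
    have h := (Finset.card_le_card hsub).trans (Finset.card_insert_le _ _)
    simp only [card_neighborFinset_eq_degree] at h
    omega

section Components

variable {H : SimpleGraph V}

lemma ConnectedComponent.supp_subset_of_forall_adj {c : H.ConnectedComponent} {s : Set V} {v : V}
    (hvc : v ∈ c.supp) (hvs : v ∈ s) (hs : ∀ x ∈ s, ∀ y, H.Adj x y → y ∈ s) : c.supp ⊆ s := by
  intro x hx
  obtain ⟨p⟩ := c.reachable_of_mem_supp hvc hx
  clear hx hvc
  induction p with
  | nil => exact hvs
  | cons h _ ih => exact ih (hs _ hvs _ h)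

lemma ConnectedComponent.nonempty_iso_pathGraph_two {c : H.ConnectedComponent} {a b : V}
    (hac : a ∈ c.supp) (hab : H.Adj a b) (ha : ∀ x, H.Adj a x → x = b)
    (hb : ∀ x, H.Adj b x → x = a) : Nonempty (H.induce c.supp ≃g pathGraph 2) := by
  have hbc : b ∈ c.supp := c.mem_supp_of_adj_mem_supp hac hab
  have hsub : c.supp ⊆ {a, b} := by
    refine supp_subset_of_forall_adj hac (by simp) ?_
    rintro x (rfl | rfl) y hy
    · simp [ha y hy]
    · simp [hb y hy]
  let g : Fin 2 → c.supp := ![⟨a, hac⟩, ⟨b, hbc⟩]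
  have hg : Function.Bijective g := by
    constructor
    · intro i j h
      have := hab.ne
      fin_cases i <;> fin_cases j <;> simp_all [g]
    · rintro ⟨x, hx⟩
      rcases hsub hx with rfl | rfl
      exacts [⟨0, rfl⟩, ⟨1, rfl⟩]
  refine ⟨RelIso.symm ⟨Equiv.ofBijective g hg, ?_⟩⟩
  intro i j
  have := hab.symm
  fin_cases i <;> fin_cases j <;> simp_all [g, pathGraph_adj]

lemma ConnectedComponent.nonempty_iso_pathGraph_three {c : H.ConnectedComponent} {a b d : V}
    (hbc : b ∈ c.supp) (hba : H.Adj b a) (hbd : H.Adj b d) (had : a ≠ d)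
    (ha : ∀ x, H.Adj a x → x = b) (hd : ∀ x, H.Adj d x → x = b)
    (hb : ∀ x, H.Adj b x → x = a ∨ x = d) : Nonempty (H.induce c.supp ≃g pathGraph 3) := by
  have hac : a ∈ c.supp := c.mem_supp_of_adj_mem_supp hbc hba
  have hdc : d ∈ c.supp := c.mem_supp_of_adj_mem_supp hbc hbd
  have hsub : c.supp ⊆ {a, b, d} := by
    refine supp_subset_of_forall_adj hbc (by simp) ?_
    rintro x (rfl | rfl | rfl) y hy
    · simp [ha y hy]
    · rcases hb y hy with rfl | rfl <;> simp
    · simp [hd y hy]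
  let g : Fin 3 → c.supp := ![⟨a, hac⟩, ⟨b, hbc⟩, ⟨d, hdc⟩]
  have hnad : ¬ H.Adj a d := fun h => hbd.ne (ha d h).symm
  have hnda : ¬ H.Adj d a := fun h => hnad h.symm
  have hg : Function.Bijective g := by
    constructor
    · intro i j h
      have h₁ := hba.ne
      have h₂ := hbd.ne
      have h₃ := hba.ne'
      have h₄ := hbd.ne'
      have h₅ := had.symm
      fin_cases i <;> fin_cases j <;> simp_all [g]
    · rintro ⟨x, hx⟩
      rcases hsub hx with rfl | rfl | rfl
      exacts [⟨0, rfl⟩, ⟨1, rfl⟩, ⟨2, rfl⟩]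
  refine ⟨RelIso.symm ⟨Equiv.ofBijective g hg, ?_⟩⟩
  intro i j
  have h₁ := hba.symm
  have h₂ := hbd.symm
  clear ha hb hd
  fin_cases i <;> fin_cases j <;> simp_all [g, pathGraph_adj]

/-- In a graph of maximum degree at most two in which every walk of length three backtracks,
the nontrivial components are paths on two or three vertices. -/
lemma ConnectedComponent.nonempty_iso_pathGraph_two_or_three
    (hthree : ∀ w x y z, H.Adj w x → H.Adj x y → H.Adj y z → w = y ∨ x = z)
    (htwo : ∀ v x y z, H.Adj v x → H.Adj v y → H.Adj v z → x = y ∨ x = z ∨ y = z)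
    (c : H.ConnectedComponent) (hc : ∃ v ∈ c.supp, ∃ w, H.Adj v w) :
    Nonempty (H.induce c.supp ≃g pathGraph 2) ∨ Nonempty (H.induce c.supp ≃g pathGraph 3) := by
  have hcherry : ∀ b ∈ c.supp, ∀ a d, H.Adj b a → H.Adj b d → a ≠ d →
      Nonempty (H.induce c.supp ≃g pathGraph 3) := by
    intro b hbc a d hba hbd had
    refine nonempty_iso_pathGraph_three hbc hba hbd had ?_ ?_ ?_
    · intro x hx
      exact ((hthree d b a x hbd.symm hba hx).resolve_left had.symm).symm
    · intro x hx
      exact ((hthree a b d x hba.symm hbd hx).resolve_left had).symm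
    · intro x hx
      have := htwo b x a d hx hba hbd
      tauto
  obtain ⟨v, hv, w, hvw⟩ := hc
  by_cases h₁ : ∀ x, H.Adj v x → x = w
  · by_cases h₂ : ∀ x, H.Adj w x → x = v
    · exact Or.inl (nonempty_iso_pathGraph_two hv hvw h₁ h₂)
    · push Not at h₂
      obtain ⟨x, hx, hne⟩ := h₂
      exact Or.inr (hcherry w (c.mem_supp_of_adj_mem_supp hv hvw) x v hx hvw.symm hne)
  · push Not at h₁
    obtain ⟨x, hx, hne⟩ := h₁
    exact Or.inr (hcherry v hv x w hx hvw hne)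

end Components

/-- A matching `F` together with one pendant edge from each exposed vertex of `M`. -/
noncomputable def pendantExtension (M : Finset V) (F : Finset (Sym2 V)) (f : V → V) :
    Finset (Sym2 V) :=
  F ∪ (exposed M F).image fun u => s(u, f u)

lemma mk_mem_pendantExtension {M : Finset V} {F : Finset (Sym2 V)} {f : V → V} {x y : V} :
    s(x, y) ∈ pendantExtension M F f ↔
      s(x, y) ∈ F ∨ (x ∈ exposed M F ∧ f x = y) ∨ (y ∈ exposed M F ∧ f y = x) := by
  simp only [pendantExtension, Finset.mem_union, Finset.mem_image, Sym2.eq_iff]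
  grind

lemma card_pendantExtension_le (M : Finset V) (F : Finset (Sym2 V)) (f : V → V) :
    (pendantExtension M F f).card ≤ F.card + (exposed M F).card :=
  (Finset.card_union_le _ _).trans (Nat.add_le_add_left Finset.card_image_le _)

section PendantExtension

variable {G : SimpleGraph V} {M : Finset V} {F : Finset (Sym2 V)} {f : V → V}

lemma notMem_exposed_of_isMatchingOn_of_forall_card_le (hF : G.IsMatchingOn M F)
    (hmax : ∀ F', G.IsMatchingOn M F' → F'.card ≤ F.card) {u w : V} (hu : u ∈ exposed M F)
    (h : G.Adj u w) : w ∉ exposed M F := by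
  intro hw
  have := hmax _ (hF.insert_edge hu hw h)
  rw [card_insert_of_mem_exposed hu] at this
  omega

/-- A maximum matching has no augmenting path of length three. -/
lemma mk_notMem_of_forall_card_le (hF : G.IsMatchingOn M F)
    (hmax : ∀ F', G.IsMatchingOn M F' → F'.card ≤ F.card) {u x y w : V}
    (hu : u ∈ exposed M F) (hw : w ∈ exposed M F) (huw : u ≠ w) (hux : G.Adj u x)
    (hwy : G.Adj w y) : s(x, y) ∉ F := by
  intro hxy
  have hmatch := hF.erase s(x, y)
  have hne : x ≠ y := G.ne_of_adj (hF.mem_edgeSet _ hxy)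
  have hu' := mem_exposed.1 hu
  have hw' := mem_exposed.1 hw
  have hxu : x ≠ u := hux.ne'
  have hyw : y ≠ w := hwy.ne'
  have hxw : x ≠ w := by rintro rfl; exact hw'.2 _ hxy (Sym2.mem_mk_left _ _)
  have hyu : y ≠ u := by rintro rfl; exact hu'.2 _ hxy (Sym2.mem_mk_right _ _)
  have hends : ∀ v ∈ s(x, y), v ∈ exposed M (F.erase s(x, y)) := by
    intro v hv
    refine mem_exposed.2 ⟨hF.mem_of_mem _ hxy v hv, fun e he hve => ?_⟩
    exact Finset.ne_of_mem_erase he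
      (hF.eq_of_mem _ (Finset.mem_of_mem_erase he) _ hxy v hve hv)
  have hmono : ∀ v ∈ exposed M F, v ∈ exposed M (F.erase s(x, y)) := by
    intro v hv
    rw [mem_exposed] at hv ⊢
    exact ⟨hv.1, fun e he => hv.2 e (Finset.mem_of_mem_erase he)⟩
  have hkeep : ∀ v ∈ exposed M (F.erase s(x, y)), v ≠ u → v ≠ x →
      v ∈ exposed M (insert s(u, x) (F.erase s(x, y))) := by
    intro v hv hvu hvx
    rw [mem_exposed] at hv ⊢
    refine ⟨hv.1, fun e he => ?_⟩
    rcases Finset.mem_insert.1 he with rfl | he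
    · simp [hvu, hvx]
    · exact hv.2 e he
  have h₁ := hmatch.insert_edge (hmono u hu) (hends x (Sym2.mem_mk_left _ _)) hux
  have hw₁ := hkeep w (hmono w hw) huw.symm hxw.symm
  have h₂ := hmax _
    (h₁.insert_edge hw₁ (hkeep y (hends y (Sym2.mem_mk_right _ _)) hyu hne.symm) hwy)
  rw [card_insert_of_mem_exposed hw₁, card_insert_of_mem_exposed (hmono u hu),
    Finset.card_erase_of_mem hxy] at h₂
  have := Finset.card_pos.2 ⟨_, hxy⟩
  omega

lemma IsMatchingOn.mk_right_unique (hF : G.IsMatchingOn M F) {x y z : V} (h : s(x, y) ∈ F)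
    (h' : s(x, z) ∈ F) : y = z :=
  Sym2.congr_right.1 (hF.eq_of_mem _ h _ h' x (Sym2.mem_mk_left _ _) (Sym2.mem_mk_left _ _))

lemma mk_notMem_of_mem_exposed {x : V} (hx : x ∈ exposed M F) (y : V) : s(x, y) ∉ F :=
  fun h => (mem_exposed.1 hx).2 _ h (Sym2.mem_mk_left _ _)

lemma eq_of_mk_mem_pendantExtension (hf : ∀ u ∈ exposed M F, f u ∉ exposed M F) {u x : V}
    (hu : u ∈ exposed M F) (h : s(u, x) ∈ pendantExtension M F f) : x = f u := by
  rcases mk_mem_pendantExtension.1 h with h | ⟨_, h⟩ | ⟨hx, h⟩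
  · exact absurd h (mk_notMem_of_mem_exposed hu x)
  · exact h.symm
  · exact absurd (h ▸ hu) (hf x hx)

lemma pendantExtension_eq_or_eq (hF : G.IsMatchingOn M F)
    (hmax : ∀ F', G.IsMatchingOn M F' → F'.card ≤ F.card) (hadj : ∀ u ∈ M, G.Adj u (f u))
    (w x y z : V) (hwx : s(w, x) ∈ pendantExtension M F f)
    (hxy : s(x, y) ∈ pendantExtension M F f) (hyz : s(y, z) ∈ pendantExtension M F f) :
    w = y ∨ x = z := by
  have hf : ∀ u ∈ exposed M F, f u ∉ exposed M F := fun u hu =>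
    notMem_exposed_of_isMatchingOn_of_forall_card_le hF hmax hu (hadj u (mem_exposed.1 hu).1)
  rw [Sym2.eq_swap] at hwx
  by_cases hx : x ∈ exposed M F
  · left
    rw [eq_of_mk_mem_pendantExtension hf hx hwx, eq_of_mk_mem_pendantExtension hf hx hxy]
  by_cases hy : y ∈ exposed M F
  · right
    rw [Sym2.eq_swap] at hxy
    rw [eq_of_mk_mem_pendantExtension hf hy hxy, eq_of_mk_mem_pendantExtension hf hy hyz]
  have hxyF : s(x, y) ∈ F := by
    have := mk_mem_pendantExtension.1 hxy
    tauto
  rcases mk_mem_pendantExtension.1 hwx with h | ⟨h, _⟩ | ⟨hw, hwf⟩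
  · exact Or.inl (hF.mk_right_unique h hxyF)
  · exact absurd h hx
  rcases mk_mem_pendantExtension.1 hyz with h | ⟨h, _⟩ | ⟨hz, hzf⟩
  · exact Or.inr (hF.mk_right_unique (Sym2.eq_swap ▸ hxyF) h)
  · exact absurd h hy
  have hwz : w ≠ z := by
    rintro rfl
    exact G.ne_of_adj (hF.mem_edgeSet _ hxyF) (hwf.symm.trans hzf)
  exact absurd hxyF (mk_notMem_of_forall_card_le hF hmax hw hz hwz
    (hwf ▸ hadj w (mem_exposed.1 hw).1) (hzf ▸ hadj z (mem_exposed.1 hz).1))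

lemma pendantExtension_eq_or_eq_or_eq (hF : G.IsMatchingOn M F)
    (hf : ∀ u ∈ exposed M F, f u ∉ exposed M F) (hinj : Set.InjOn f M)
    (v x y z : V) (hx : s(v, x) ∈ pendantExtension M F f)
    (hy : s(v, y) ∈ pendantExtension M F f) (hz : s(v, z) ∈ pendantExtension M F f) :
    x = y ∨ x = z ∨ y = z := by
  by_cases hv : v ∈ exposed M F
  · left
    rw [eq_of_mk_mem_pendantExtension hf hv hx, eq_of_mk_mem_pendantExtension hf hv hy]
  have hinj' : ∀ a ∈ exposed M F, ∀ b ∈ exposed M F, f a = f b → a = b := fun a ha b hb h =>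
    hinj (mem_exposed.1 ha).1 (mem_exposed.1 hb).1 h
  have huniq : ∀ a b, s(v, a) ∈ F → s(v, b) ∈ F → a = b := fun a b => hF.mk_right_unique
  simp only [mk_mem_pendantExtension, hv, false_and, false_or] at hx hy hz
  grind

end PendantExtension

end SimpleGraph

/-- There exists a minimum mitigating set all of whose components (of the subgraph of `G`
induced by this edge set) are paths on 2 or 3 vertices. -/
theorem stmt_0 [Fintype V] (G : SimpleGraph V) (hE : G.edgeSet.Nonempty) :
    ∃ S : Set (Sym2 V), G.IsMitigating S ∧ S.ncard = G.esDelta ∧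
      ∀ c : (SimpleGraph.fromEdgeSet S).ConnectedComponent,
        (∃ v ∈ c.supp, ∃ w, (SimpleGraph.fromEdgeSet S).Adj v w) →
          Nonempty ((SimpleGraph.fromEdgeSet S).induce c.supp ≃g SimpleGraph.pathGraph 2) ∨
          Nonempty ((SimpleGraph.fromEdgeSet S).induce c.supp ≃g SimpleGraph.pathGraph 3) := by
  have hpos : 0 < G.maxDegree := by
    obtain ⟨e, he⟩ := hE
    induction e using Sym2.ind with
    | _ a b =>
      refine lt_of_lt_of_le ?_ (G.degree_le_maxDegree a)
      exact (G.degree_pos_iff_exists_adj a).2 ⟨b, he⟩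
  have : Nonempty V := by
    obtain ⟨e, -⟩ := hE
    induction e using Sym2.ind with
    | _ a b => exact ⟨a⟩
  let M : Finset V := Finset.univ.filter fun v => G.degree v = G.maxDegree
  have hM : ∀ v, v ∈ M ↔ G.degree v = G.maxDegree := by simp [M]
  obtain ⟨f, hinj, hadj⟩ := G.exists_injOn_adj_of_degree_eq_maxDegree hpos
  replace hinj : Set.InjOn f M := fun a ha b hb => hinj ((hM a).1 ha) ((hM b).1 hb)
  replace hadj : ∀ u ∈ M, G.Adj u (f u) := fun u hu => hadj u ((hM u).1 hu)
  obtain ⟨F, hF, hmax⟩ := Finset.exists_max_image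
    (Finset.univ.filter fun F => G.IsMatchingOn M F) Finset.card
    ⟨∅, by simp [isMatchingOn_empty]⟩
  simp only [Finset.mem_filter, Finset.mem_univ, true_and] at hF hmax
  have hf : ∀ u ∈ exposed M F, f u ∉ exposed M F := fun u hu =>
    notMem_exposed_of_isMatchingOn_of_forall_card_le hF hmax hu (hadj u (mem_exposed.1 hu).1)
  have hpend : ∀ u ∈ exposed M F, s(u, f u) ∈ pendantExtension M F f := fun u hu =>
    mk_mem_pendantExtension.2 (Or.inr (Or.inl ⟨hu, rfl⟩))
  have hFsub : F ⊆ pendantExtension M F f := Finset.subset_union_left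
  have hcov : ∀ v ∈ M, ∃ e ∈ pendantExtension M F f, v ∈ e := by
    intro v hv
    by_cases hvF : v ∈ exposed M F
    · exact ⟨_, hpend v hvF, Sym2.mem_mk_left _ _⟩
    · have : ∃ e ∈ F, v ∈ e := by
        by_contra! h
        exact hvF (mem_exposed.2 ⟨hv, h⟩)
      obtain ⟨e, he, hve⟩ := this
      exact ⟨e, hFsub he, hve⟩
  have hsub : (pendantExtension M F f : Set (Sym2 V)) ⊆ G.edgeSet := by
    intro e he
    rcases Finset.mem_union.1 (Finset.mem_coe.1 he) with he | he
    · exact hF.mem_edgeSet e he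
    · obtain ⟨u, hu, rfl⟩ := Finset.mem_image.1 he
      exact hadj u (mem_exposed.1 hu).1
  have hleaf : ∃ v ∈ M, ∃ w, ∀ x, s(v, x) ∈ pendantExtension M F f → x = w := by
    by_cases hU : (exposed M F).Nonempty
    · obtain ⟨u, hu⟩ := hU
      exact ⟨u, (mem_exposed.1 hu).1, f u, fun x hx => eq_of_mk_mem_pendantExtension hf hu hx⟩
    · obtain ⟨v, hv⟩ := G.exists_maximal_degree_vertex
      have hvM : v ∈ M := (hM v).2 hv.symm
      have hnone : ∀ x, x ∉ exposed M F := fun x hx => hU ⟨x, hx⟩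
      obtain ⟨e, he, hve⟩ := hcov v hvM
      obtain ⟨w, rfl⟩ := Sym2.mem_iff_exists.1 hve
      simp only [mk_mem_pendantExtension, hnone, false_and, or_false] at he
      refine ⟨v, hvM, w, fun x hx => ?_⟩
      simp only [mk_mem_pendantExtension, hnone, false_and, or_false] at hx
      exact hF.mk_right_unique hx he
  obtain ⟨v, hvM, w, hvw⟩ := hleaf
  have hmit : G.IsMitigating (pendantExtension M F f : Set (Sym2 V)) :=
    isMitigating_of_forall_exists_mem hsub (fun x hx => hcov x ((hM x).2 hx)) ((hM v).1 hvM) hvw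
  refine ⟨_, hmit, le_antisymm ?_ (Nat.sInf_le ⟨_, hmit, rfl⟩), ?_⟩
  · refine le_csInf ⟨_, _, hmit, rfl⟩ ?_
    rintro n ⟨S, hS, rfl⟩
    obtain ⟨F', hF', hle⟩ := G.exists_isMatchingOn_card_le M S.toFinset
      (fun e he => hS.1 (Set.mem_toFinset.1 he)) (fun x hx => by
        obtain ⟨e, he, hxe⟩ := hS.exists_mem hpos ((hM x).1 hx)
        exact ⟨e, Set.mem_toFinset.2 he, hxe⟩)
    have h₁ := hmax F' hF'
    have h₂ := hF.card_exposed
    have h₃ := card_pendantExtension_le M F f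
    rw [Set.ncard_coe_finset, Set.ncard_eq_toFinset_card']
    omega
  · refine fun c => ConnectedComponent.nonempty_iso_pathGraph_two_or_three ?_ ?_ c
    · intro w x y z hwx hxy hyz
      exact pendantExtension_eq_or_eq hF hmax hadj w x y z ((fromEdgeSet_adj _).1 hwx).1
        ((fromEdgeSet_adj _).1 hxy).1 ((fromEdgeSet_adj _).1 hyz).1
    · intro v x y z hx hy hz
      exact pendantExtension_eq_or_eq_or_eq hF hf hinj v x y z ((fromEdgeSet_adj _).1 hx).1
        ((fromEdgeSet_adj _).1 hy).1 ((fromEdgeSet_adj _).1 hz).1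
end

section
/- Let G be a finite simple graph with at least one edge and of order n. Then es_Δ(G) ≤ n − α(G), where α(G) denotes the independence number of G. -/
open SimpleGraph

attribute [local instance] Classical.propDecidable

universe u

variable {V : Type u}

/-- The independence number of `G`: maximum cardinality of a set of pairwise
non-adjacent vertices. -/
noncomputable def SimpleGraph.indepNumber [Fintype V] (G : SimpleGraph V) : ℕ :=
  sSup {n | ∃ s : Set V, (∀ v ∈ s, ∀ w ∈ s, ¬ G.Adj v w) ∧ s.ncard = n}

namespace SimpleGraph

/-- The independence number is attained. -/
lemma exists_ncard_eq_indepNumber [Fintype V] (G : SimpleGraph V) :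
    ∃ I : Set V, (∀ v ∈ I, ∀ w ∈ I, ¬ G.Adj v w) ∧ I.ncard = G.indepNumber := by
  refine Nat.sSup_mem (s := {n | ∃ s : Set V, (∀ v ∈ s, ∀ w ∈ s, ¬ G.Adj v w) ∧ s.ncard = n})
    ⟨0, ∅, by simp⟩ ⟨Fintype.card V, ?_⟩
  rintro n ⟨s, -, rfl⟩
  rw [← Nat.card_eq_fintype_card]
  exact Set.ncard_le_card s

/-- The vertices of maximum degree in `I` can be mapped injectively to neighbours: this is Hall's
theorem together with a double count of the edges leaving a set of such vertices. -/
lemma exists_injective_adj_of_maxDegree [Fintype V] (G : SimpleGraph V)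
    (hpos : 0 < G.maxDegree) (I : Set V) :
    ∃ f : {v // v ∈ I ∧ G.degree v = G.maxDegree} → V,
      Function.Injective f ∧ ∀ v, G.Adj v.1 (f v) := by
  obtain ⟨f, hf, hft⟩ := (Finset.all_card_le_biUnion_card_iff_exists_injective
    (fun v : {v // v ∈ I ∧ G.degree v = G.maxDegree} => G.neighborFinset v)).1 fun A => by
      have key := Finset.card_mul_le_card_mul (s := A)
        (t := A.biUnion fun v => G.neighborFinset v) (m := G.maxDegree) (n := G.maxDegree)
        (fun v w => G.Adj v.1 w) (fun v hv => ?_) (fun w _ => ?_)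
      · exact Nat.le_of_mul_le_mul_right key hpos
      · refine v.2.2.ge.trans ?_
        rw [← G.card_neighborFinset_eq_degree]
        refine Finset.card_le_card fun w hw => ?_
        rw [Finset.mem_bipartiteAbove]
        exact ⟨Finset.mem_biUnion.2 ⟨v, hv, hw⟩, by simpa using hw⟩
      · refine le_trans ?_ (G.degree_le_maxDegree w)
        rw [← G.card_neighborFinset_eq_degree]
        refine Finset.card_le_card_of_injOn Subtype.val (fun v hv => ?_)
          Subtype.val_injective.injOn
        have := (Finset.mem_bipartiteBelow _).1 hv
        simpa using this.2.symm
  exact ⟨f, hf, fun v => by simpa using hft v⟩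

/-- For an independent set `I`, at most `|Iᶜ|` edges meet every vertex of maximum degree. -/
lemma exists_edges_cover_maxDegree [Fintype V] (G : SimpleGraph V)
    (hpos : 0 < G.maxDegree) (I : Set V) (hI : ∀ v ∈ I, ∀ w ∈ I, ¬ G.Adj v w) :
    ∃ S ⊆ G.edgeSet, S.ncard ≤ Iᶜ.ncard ∧
      ∀ v, G.degree v = G.maxDegree → ∃ e ∈ S, v ∈ e := by
  obtain ⟨f, hf, hadj⟩ := G.exists_injective_adj_of_maxDegree hpos I
  have hg : ∀ w, ∃ x, (0 < G.degree w → G.Adj w x) ∧ ∀ v, f v = w → x = v := by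
    intro w
    by_cases h : ∃ v, f v = w
    · obtain ⟨v, rfl⟩ := h
      exact ⟨v, fun _ => (hadj v).symm, fun v' hv' => by rw [hf hv']⟩
    · by_cases hd : 0 < G.degree w
      · obtain ⟨x, hx⟩ := (G.degree_pos_iff_exists_adj w).1 hd
        exact ⟨x, fun _ => hx, fun v hv => (h ⟨v, hv⟩).elim⟩
      · exact ⟨w, fun h' => (hd h').elim, fun v hv => (h ⟨v, hv⟩).elim⟩
  choose g hg hgf using hg
  refine ⟨(fun w => s(w, g w)) '' {w | w ∈ Iᶜ ∧ 0 < G.degree w}, ?_, ?_, fun v hv => ?_⟩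
  · rintro _ ⟨w, hw, rfl⟩
    exact hg w hw.2
  · exact (Set.ncard_image_le (Set.toFinite _)).trans
      (Set.ncard_le_ncard (fun w hw => hw.1) (Set.toFinite _))
  · by_cases hvI : v ∈ I
    · have hvf := hadj ⟨v, hvI, hv⟩
      refine ⟨_, ⟨f ⟨v, hvI, hv⟩, ⟨fun h => hI _ hvI _ h hvf, ?_⟩, rfl⟩, ?_⟩
      · exact (G.degree_pos_iff_exists_adj _).2 ⟨v, hvf.symm⟩
      · simp only [hgf _ _ rfl]
        exact Sym2.mem_mk_right _ _
    · exact ⟨_, ⟨v, ⟨hvI, hv ▸ hpos⟩, rfl⟩, Sym2.mem_mk_left _ _⟩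

lemma incidenceSet_deleteEdges (G : SimpleGraph V) (S : Set (Sym2 V)) (v : V) :
    (G.deleteEdges S).incidenceSet v = G.incidenceSet v \ S := by
  ext e
  simp only [incidenceSet, edgeSet_deleteEdges, Set.mem_sdiff, Set.mem_ofPred_eq]
  tauto

/-- Deleting one edge more lowers a degree by at most one. -/
lemma degree_deleteEdges_le_of_subset_insert [Fintype V] (G : SimpleGraph V)
    {S T : Set (Sym2 V)} {e : Sym2 V} (h : T ⊆ insert e S) (v : V) :
    (G.deleteEdges S).degree v ≤ (G.deleteEdges T).degree v + 1 := by
  rw [← card_incidenceFinset_eq_degree, ← card_incidenceFinset_eq_degree]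
  refine (Finset.card_le_card fun x hx => ?_).trans (Finset.card_insert_le e _)
  simp only [Finset.mem_insert, mem_incidenceFinset, incidenceSet_deleteEdges,
    Set.mem_sdiff] at hx ⊢
  have := @h x
  rw [Set.mem_insert_iff] at this
  tauto

/-- Deleting edges that meet every vertex of maximum degree lowers the maximum degree. -/
lemma maxDegree_deleteEdges_lt [Fintype V] (G : SimpleGraph V) (hpos : 0 < G.maxDegree)
    {S : Set (Sym2 V)} (hS : S ⊆ G.edgeSet)
    (hcov : ∀ v, G.degree v = G.maxDegree → ∃ e ∈ S, v ∈ e) :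
    (G.deleteEdges S).maxDegree < G.maxDegree := by
  refine Nat.lt_of_le_pred hpos (maxDegree_le_of_forall_degree_le _ _ fun v => Nat.le_pred_of_lt ?_)
  have hle : (G.deleteEdges S).incidenceFinset v ⊆ G.incidenceFinset v := fun x hx => by
    simp only [mem_incidenceFinset, incidenceSet_deleteEdges] at hx ⊢
    exact hx.1
  rcases (G.degree_le_maxDegree v).lt_or_eq with h | h
  · refine lt_of_le_of_lt ?_ h
    rw [← card_incidenceFinset_eq_degree, ← card_incidenceFinset_eq_degree]
    exact Finset.card_le_card hle
  · obtain ⟨e, heS, hve⟩ := hcov v h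
    rw [← h, ← card_incidenceFinset_eq_degree, ← card_incidenceFinset_eq_degree]
    refine Finset.card_lt_card ((Finset.ssubset_iff_of_subset hle).2 ⟨e, ?_, ?_⟩)
    · exact (mem_incidenceFinset _ _ _).2 ⟨hS heS, hve⟩
    · simp [incidenceSet_deleteEdges, heS]

/-- A set of edges whose deletion lowers the maximum degree contains a mitigating set. -/
lemma exists_isMitigating_subset [Fintype V] (G : SimpleGraph V)
    {S : Set (Sym2 V)} (hS : S ⊆ G.edgeSet) (hlt : (G.deleteEdges S).maxDegree < G.maxDegree) :
    ∃ T ⊆ S, G.IsMitigating T := by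
  obtain ⟨T, hTS, hT⟩ := exists_minimal_le_of_wellFoundedLT
    (fun T : Set (Sym2 V) => (G.deleteEdges T).maxDegree < G.maxDegree) S hlt
  refine ⟨T, hTS, hTS.trans hS, le_antisymm (Nat.le_pred_of_lt hT.prop) ?_⟩
  obtain ⟨e, he⟩ : T.Nonempty := by
    rw [Set.nonempty_iff_ne_empty]
    rintro rfl
    simpa using hT.prop
  obtain ⟨R, hRT, heR, hTR⟩ : ∃ R ⊆ T, e ∉ R ∧ T ⊆ insert e R :=
    ⟨T \ {e}, Set.sdiff_subset, fun h => h.2 rfl, by simp⟩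
  have hmax : G.maxDegree ≤ (G.deleteEdges R).maxDegree := by
    by_contra! h
    exact heR (hT.le_of_le h hRT he)
  have : Nonempty V := ⟨e.out.1⟩
  obtain ⟨v, hv⟩ := (G.deleteEdges R).exists_maximal_degree_vertex
  have h₁ := G.degree_deleteEdges_le_of_subset_insert hTR v
  have h₂ := (G.deleteEdges T).degree_le_maxDegree v
  omega

end SimpleGraph

/-- `es_Δ(G) ≤ n − α(G)`. -/
theorem stmt_1 [Fintype V] (G : SimpleGraph V) (hE : G.edgeSet.Nonempty) :
    G.esDelta ≤ Fintype.card V - G.indepNumber := by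
  have hpos : 0 < G.maxDegree := by
    obtain ⟨e, he⟩ := hE
    induction e with | _ a b
    exact ((G.degree_pos_iff_exists_adj a).2 ⟨b, he⟩).trans_le (G.degree_le_maxDegree a)
  obtain ⟨I, hI, hcard⟩ := G.exists_ncard_eq_indepNumber
  obtain ⟨S, hS, hSI, hcov⟩ := G.exists_edges_cover_maxDegree hpos I hI
  obtain ⟨T, hTS, hT⟩ := G.exists_isMitigating_subset hS (G.maxDegree_deleteEdges_lt hpos hS hcov)
  calc G.esDelta ≤ T.ncard := Nat.sInf_le ⟨T, hT, rfl⟩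
    _ ≤ S.ncard := Set.ncard_le_ncard hTS (Set.toFinite _)
    _ ≤ Iᶜ.ncard := hSI
    _ = Fintype.card V - G.indepNumber := by
      rw [Set.ncard_compl, hcard, Nat.card_eq_fintype_card]
end

section
/- The bound es_Δ(G) ≤ n − α(G) is sharp: if G is a regular bipartite graph of order n with at least one edge that has a perfect matching, then es_Δ(G) = n/2 = n − α(G). -/
open SimpleGraph

attribute [local instance] Classical.propDecidable

universe u

variable {V : Type u}

namespace SimpleGraph

lemma two_mul_ncard_edgeSet_eq_sum_degrees [Fintype V] (G : SimpleGraph V) :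
    2 * G.edgeSet.ncard = ∑ v, G.degree v := by
  rw [G.sum_degrees_eq_twice_card_edges, ← coe_edgeFinset, Set.ncard_coe_finset]

lemma ncard_edgeSet_deleteEdges_add_ncard [Fintype V] (G : SimpleGraph V) {S : Set (Sym2 V)}
    (hS : S ⊆ G.edgeSet) : (G.deleteEdges S).edgeSet.ncard + S.ncard = G.edgeSet.ncard := by
  rw [edgeSet_deleteEdges]
  exact Set.ncard_sdiff_add_ncard_of_subset hS

/-- Lowering the maximum degree of a regular graph requires touching every vertex. -/
lemma IsMitigating.card_le_two_mul_ncard [Fintype V] [Nonempty V] {G : SimpleGraph V} {k : ℕ}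
    (hreg : G.IsRegularOfDegree k) (hk : 0 < k) {S : Set (Sym2 V)} (hS : G.IsMitigating S) :
    Fintype.card V ≤ 2 * S.ncard := by
  obtain ⟨hSG, hmax⟩ := hS
  rw [hreg.maxDegree_eq] at hmax
  have hG : 2 * G.edgeSet.ncard = Fintype.card V * k := by
    simp [two_mul_ncard_edgeSet_eq_sum_degrees, hreg.degree_eq]
  have hG' : 2 * (G.deleteEdges S).edgeSet.ncard ≤ Fintype.card V * (k - 1) := by
    rw [two_mul_ncard_edgeSet_eq_sum_degrees, ← hmax]
    exact Finset.sum_le_card_nsmul _ _ _ fun v _ =>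
      le_trans (le_of_eq (by congr!)) ((G.deleteEdges S).degree_le_maxDegree v)
  have hsum := ncard_edgeSet_deleteEdges_add_ncard G hSG
  obtain ⟨j, rfl⟩ : ∃ j, k = j + 1 := ⟨k - 1, by omega⟩
  rw [Nat.add_sub_cancel] at hG'
  rw [mul_add] at hG
  omega

lemma Subgraph.IsPerfectMatching.two_mul_ncard_edgeSet [Fintype V] {G : SimpleGraph V}
    {M : G.Subgraph} (hM : M.IsPerfectMatching) : 2 * M.edgeSet.ncard = Fintype.card V := by
  rw [← Subgraph.edgeSet_spanningCoe, two_mul_ncard_edgeSet_eq_sum_degrees]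
  rw [Subgraph.isPerfectMatching_iff_forall_degree] at hM
  simp [Subgraph.degree_spanningCoe, hM]

lemma Subgraph.IsPerfectMatching.isMitigating_edgeSet [Fintype V] [Nonempty V]
    {G : SimpleGraph V} {k : ℕ} (hreg : G.IsRegularOfDegree k) {M : G.Subgraph}
    (hM : M.IsPerfectMatching) : G.IsMitigating M.edgeSet := by
  refine ⟨M.edgeSet_subset, ?_⟩
  have hdel : (G.deleteEdges M.edgeSet).IsRegularOfDegree (k - 1) := by
    intro v
    obtain ⟨w, hw, huniq⟩ := Subgraph.isPerfectMatching_iff.mp hM v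
    have hset : (G.deleteEdges M.edgeSet).neighborFinset v = (G.neighborFinset v).erase w := by
      ext x
      rw [mem_neighborFinset, SimpleGraph.deleteEdges_adj, Subgraph.mem_edgeSet, Finset.mem_erase,
        mem_neighborFinset]
      refine ⟨fun h => ⟨?_, h.1⟩, fun h => ⟨h.2, fun hx => h.1 (huniq x hx)⟩⟩
      rintro rfl
      exact h.2 hw
    rw [← card_neighborFinset_eq_degree, hset,
      Finset.card_erase_of_mem ((G.mem_neighborFinset v w).mpr hw.adj_sub),
      card_neighborFinset_eq_degree, hreg.degree_eq]
  rw [hreg.maxDegree_eq, hdel.maxDegree_eq]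

lemma Subgraph.IsPerfectMatching.two_mul_ncard_le [Fintype V] {G : SimpleGraph V}
    {M : G.Subgraph} (hM : M.IsPerfectMatching) {s : Set V}
    (hs : ∀ v ∈ s, ∀ w ∈ s, ¬ G.Adj v w) : 2 * s.ncard ≤ Fintype.card V := by
  choose f hf _ using Subgraph.isPerfectMatching_iff.mp hM
  have hinj : Set.InjOn f s := fun a _ b _ hab =>
    hM.1.eq_of_adj_right (hf a) (hab ▸ hf b)
  have hle : s.ncard ≤ sᶜ.ncard :=
    Set.ncard_le_ncard_of_injOn f (fun a ha hfa => hs a ha _ hfa (hf a).adj_sub) hinj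
  have hadd := Set.ncard_add_ncard_compl s
  rw [Nat.card_eq_fintype_card] at hadd
  omega

lemma Colorable.exists_card_le_two_mul_ncard [Fintype V] {G : SimpleGraph V}
    (hbip : G.Colorable 2) : ∃ s : Set V, (∀ v ∈ s, ∀ w ∈ s, ¬ G.Adj v w) ∧
      Fintype.card V ≤ 2 * s.ncard := by
  obtain ⟨c⟩ := hbip
  have hind (i : Fin 2) : ∀ v ∈ c.colorClass i, ∀ w ∈ c.colorClass i, ¬ G.Adj v w :=
    fun v hv w hw hadj => c.valid hadj (hv.trans hw.symm)
  have hadd := Set.ncard_add_ncard_compl (c.colorClass 0)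
  have hcompl : (c.colorClass 0)ᶜ = c.colorClass 1 := by
    ext v
    change c v ≠ 0 ↔ c v = 1
    lia
  rw [hcompl, Nat.card_eq_fintype_card] at hadd
  by_cases h : Fintype.card V ≤ 2 * (c.colorClass 0).ncard
  · exact ⟨_, hind 0, h⟩
  · exact ⟨_, hind 1, by omega⟩

lemma Subgraph.IsPerfectMatching.esDelta_eq [Fintype V] [Nonempty V] {G : SimpleGraph V}
    {k : ℕ} (hreg : G.IsRegularOfDegree k) (hk : 0 < k) {M : G.Subgraph}
    (hM : M.IsPerfectMatching) : G.esDelta = Fintype.card V / 2 := by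
  have hcard := hM.two_mul_ncard_edgeSet
  refine IsLeast.csInf_eq ⟨⟨_, hM.isMitigating_edgeSet hreg, by omega⟩, ?_⟩
  rintro _ ⟨S, hS, rfl⟩
  have := hS.card_le_two_mul_ncard hreg hk
  omega

lemma Subgraph.IsPerfectMatching.indepNumber_eq [Fintype V] {G : SimpleGraph V}
    (hbip : G.Colorable 2) {M : G.Subgraph} (hM : M.IsPerfectMatching) :
    G.indepNumber = Fintype.card V / 2 := by
  obtain ⟨s, hs, hcard⟩ := hbip.exists_card_le_two_mul_ncard
  refine IsGreatest.csSup_eq ⟨⟨s, hs, ?_⟩, ?_⟩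
  · have := hM.two_mul_ncard_le hs
    omega
  · rintro _ ⟨t, ht, rfl⟩
    have := hM.two_mul_ncard_le ht
    omega

end SimpleGraph

/-- Sharpness of `es_Δ(G) ≤ n − α(G)`: for a regular bipartite graph with a perfect
matching (and at least one edge), `es_Δ(G) = n/2 = n − α(G)`. -/
theorem stmt_2 [Fintype V] (G : SimpleGraph V) (hE : G.edgeSet.Nonempty)
    (hreg : ∃ k, G.IsRegularOfDegree k) (hbip : G.Colorable 2)
    (hpm : ∃ M : G.Subgraph, M.IsPerfectMatching) :
    G.esDelta = Fintype.card V / 2 ∧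
      Fintype.card V / 2 = Fintype.card V - G.indepNumber := by
  obtain ⟨k, hreg⟩ := hreg
  obtain ⟨M, hM⟩ := hpm
  obtain ⟨e, he⟩ := hE
  induction e with | _ v w
  have : Nonempty V := ⟨v⟩
  have hk : 0 < k := by
    rw [← hreg.degree_eq v, degree_pos_iff_exists_adj]
    exact ⟨w, he⟩
  refine ⟨hM.esDelta_eq hreg hk, ?_⟩
  rw [hM.indepNumber_eq hbip]
  have := hM.two_mul_ncard_edgeSet
  omega
end

section
/- Let G be a finite simple graph and let A ⊆ V(G). Suppose that for every set S ⊆ V(G), the number of connected components of G − S that have odd order and all of whose vertices belong to A is at most |S|. Then there exists a matching in G that saturates A (i.e., a set of pairwise non-adjacent edges covering every vertex of A). -/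
open SimpleGraph

attribute [local instance] Classical.propDecidable

universe u

variable {V : Type u}

/-- The graph on `V ⊕ V` consisting of `G` on the left copy of `V`, together with all edges
between vertices that are not left copies of elements of `A`. -/
def SimpleGraph.cliqueExtension (G : SimpleGraph V) (A : Set V) : SimpleGraph (V ⊕ V) :=
  G.map Function.Embedding.inl ⊔
    SimpleGraph.fromRel fun x y => x ∉ Sum.inl '' A ∧ y ∉ Sum.inl '' A

lemma SimpleGraph.cliqueExtension_adj_of_mem {G : SimpleGraph V} {A : Set V} {a : V}
    (ha : a ∈ A) {y : V ⊕ V} (h : (G.cliqueExtension A).Adj (Sum.inl a) y) :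
    ∃ b, y = Sum.inl b ∧ G.Adj a b := by
  rcases h with h | h
  · obtain ⟨x, b, hab, hx, rfl⟩ := (SimpleGraph.map_adj _ _ _ _).1 h
    obtain rfl := Sum.inl_injective hx
    exact ⟨b, rfl, hab⟩
  · have hmem : (Sum.inl a : V ⊕ V) ∈ Sum.inl '' A := ⟨a, ha, rfl⟩
    rcases ((SimpleGraph.fromRel_adj _ _ _).1 h).2 with h | h
    exacts [absurd hmem h.1, absurd hmem h.2]

lemma SimpleGraph.cliqueExtension_adj_inl {G : SimpleGraph V} (A : Set V) {a b : V}
    (h : G.Adj a b) : (G.cliqueExtension A).Adj (Sum.inl a) (Sum.inl b) :=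
  Or.inl ((SimpleGraph.map_adj _ _ _ _).2 ⟨a, b, h, rfl, rfl⟩)

lemma SimpleGraph.cliqueExtension_adj_of_notMem {G : SimpleGraph V} {A : Set V} {x y : V ⊕ V}
    (hxy : x ≠ y) (hx : x ∉ Sum.inl '' A) (hy : y ∉ Sum.inl '' A) :
    (G.cliqueExtension A).Adj x y :=
  Or.inr ((SimpleGraph.fromRel_adj _ _ _).2 ⟨hxy, Or.inl ⟨hx, hy⟩⟩)

/-- The inclusion of `G` minus the trace of `S` into the clique extension minus `S`. -/
def SimpleGraph.inducedCliqueExtensionHom (G : SimpleGraph V) (A : Set V) (S : Set (V ⊕ V)) :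
    G.induce (Sum.inl ⁻¹' S)ᶜ →g ((⊤ : (G.cliqueExtension A).Subgraph).deleteVerts S).coe where
  toFun v := ⟨Sum.inl v.1, trivial, v.2⟩
  map_rel' {a b} h := by
    rw [SimpleGraph.Subgraph.coe_adj, SimpleGraph.Subgraph.deleteVerts_adj]
    exact ⟨trivial, a.2, trivial, b.2, SimpleGraph.cliqueExtension_adj_inl A h⟩

lemma SimpleGraph.inducedCliqueExtensionHom_injective (G : SimpleGraph V) (A : Set V)
    (S : Set (V ⊕ V)) : Function.Injective (G.inducedCliqueExtensionHom A S) := fun _ _ h =>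
  Subtype.ext (Sum.inl_injective (congrArg Subtype.val h))

/-- A component of the clique extension minus `S` that lies in the left copy of `A` is the image
of a component of `G` minus the trace of `S`. -/
lemma SimpleGraph.exists_image_supp_eq_of_subset (G : SimpleGraph V) (A : Set V)
    (S : Set (V ⊕ V))
    (c : ((⊤ : (G.cliqueExtension A).Subgraph).deleteVerts S).coe.ConnectedComponent)
    (hc : ∀ v ∈ c.supp, (v : V ⊕ V) ∈ Sum.inl '' A) :
    ∃ d : (G.induce (Sum.inl ⁻¹' S)ᶜ).ConnectedComponent,
      d.map (G.inducedCliqueExtensionHom A S) = c ∧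
        G.inducedCliqueExtensionHom A S '' d.supp = c.supp := by
  obtain ⟨v, hv⟩ := c.nonempty_supp
  obtain ⟨a, ha, hav⟩ := hc v hv
  have haS : a ∈ (Sum.inl ⁻¹' S : Set V)ᶜ := by
    intro h
    exact v.2.2 (hav ▸ h)
  have hva : G.inducedCliqueExtensionHom A S ⟨a, haS⟩ = v := Subtype.ext hav
  have hmap : (SimpleGraph.connectedComponentMk _ ⟨a, haS⟩).map
      (G.inducedCliqueExtensionHom A S) = c := by
    rw [SimpleGraph.ConnectedComponent.map_mk, hva]
    exact hv
  refine ⟨_, hmap, Set.Subset.antisymm ?_ ?_⟩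
  · rintro _ ⟨b, hb, rfl⟩
    rw [SimpleGraph.ConnectedComponent.mem_supp_iff] at hb ⊢
    rw [← hmap, ← hb, SimpleGraph.ConnectedComponent.map_mk]
  · intro w hw
    have hvw : ((⊤ : (G.cliqueExtension A).Subgraph).deleteVerts S).coe.Reachable v w :=
      SimpleGraph.ConnectedComponent.exact (hv.trans hw.symm)
    rw [SimpleGraph.reachable_iff_reflTransGen] at hvw
    induction hvw with
    | refl => exact ⟨_, rfl, hva⟩
    | @tail x y _ hxy ih =>
      have hx : x ∈ c.supp := (c.mem_supp_congr_adj hxy).2 hw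
      obtain ⟨b, hb, rfl⟩ := ih hx
      rw [SimpleGraph.Subgraph.coe_adj, SimpleGraph.Subgraph.deleteVerts_adj] at hxy
      obtain ⟨b', hb', hbb'⟩ := hc _ hx
      have hbA : b.1 ∈ A := by
        obtain rfl : b' = b.1 := Sum.inl_injective hbb'
        exact hb'
      obtain ⟨e, hye, hbe⟩ := SimpleGraph.cliqueExtension_adj_of_mem hbA hxy.2.2.2.2
      have heS : e ∈ (Sum.inl ⁻¹' S : Set V)ᶜ := fun h => y.2.2 (hye ▸ h)
      refine ⟨⟨e, heS⟩, ?_, Subtype.ext hye.symm⟩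
      exact (SimpleGraph.ConnectedComponent.mem_supp_congr_adj _
        (show (G.induce (Sum.inl ⁻¹' S)ᶜ).Adj b ⟨e, heS⟩ from hbe)).1 hb

/-- All components of the clique extension minus `S` that are not contained in the left copy of
`A` coincide. -/
lemma SimpleGraph.subsingleton_components_not_subset (G : SimpleGraph V) (A : Set V)
    (S : Set (V ⊕ V)) :
    {c : ((⊤ : (G.cliqueExtension A).Subgraph).deleteVerts S).coe.ConnectedComponent |
      ¬ ∀ v ∈ c.supp, (v : V ⊕ V) ∈ Sum.inl '' A}.Subsingleton := by
  intro c hc d hd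
  simp only [Set.mem_ofPred_eq, not_forall] at hc hd
  obtain ⟨v, rfl, hvA⟩ := hc
  obtain ⟨w, rfl, hwA⟩ := hd
  by_cases hvw : v = w
  · rw [hvw]
  · refine SimpleGraph.ConnectedComponent.sound (SimpleGraph.Adj.reachable ?_)
    rw [SimpleGraph.Subgraph.coe_adj, SimpleGraph.Subgraph.deleteVerts_adj]
    exact ⟨trivial, v.2.2, trivial, w.2.2,
      SimpleGraph.cliqueExtension_adj_of_notMem (fun h => hvw (Subtype.ext h)) hvA hwA⟩

lemma SimpleGraph.not_isTutteViolator_cliqueExtension [Finite V] (G : SimpleGraph V) (A : Set V)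
    (h : ∀ S : Set V,
      {c : (G.induce Sᶜ).ConnectedComponent |
        Odd c.supp.ncard ∧ ∀ v ∈ c.supp, (v : V) ∈ A}.ncard ≤ S.ncard) (S : Set (V ⊕ V)) :
    ¬ (G.cliqueExtension A).IsTutteViolator S := by
  let K := ((⊤ : (G.cliqueExtension A).Subgraph).deleteVerts S).coe
  rw [SimpleGraph.IsTutteViolator, not_lt]
  change K.oddComponents.ncard ≤ S.ncard
  let inner : Set K.ConnectedComponent := {c | Odd c.supp.ncard ∧
    ∀ v ∈ c.supp, (v : V ⊕ V) ∈ Sum.inl '' A}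
  let outer : Set K.ConnectedComponent := {c | ¬ ∀ v ∈ c.supp, (v : V ⊕ V) ∈ Sum.inl '' A}
  have hinner : inner.ncard ≤ S.ncard := by
    have hsub : inner ⊆ SimpleGraph.ConnectedComponent.map (G.inducedCliqueExtensionHom A S) ''
        {c | Odd c.supp.ncard ∧ ∀ v ∈ c.supp, (v : V) ∈ A} := by
      rintro c ⟨hodd, hc⟩
      obtain ⟨d, hd, hdc⟩ := G.exists_image_supp_eq_of_subset A S c hc
      refine ⟨d, ⟨?_, fun v hv => ?_⟩, hd⟩
      · rwa [← hdc, Set.ncard_image_of_injective _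
          (G.inducedCliqueExtensionHom_injective A S)] at hodd
      · obtain ⟨a, ha, hav⟩ := hc _ (hdc ▸ Set.mem_image_of_mem _ hv)
        obtain rfl : a = v.1 := Sum.inl_injective hav
        exact ha
    calc inner.ncard ≤ _ := Set.ncard_le_ncard hsub (Set.toFinite _)
      _ ≤ _ := Set.ncard_image_le (Set.toFinite _)
      _ ≤ (Sum.inl ⁻¹' S : Set V).ncard := h _
      _ = (Sum.inl '' (Sum.inl ⁻¹' S : Set V) : Set (V ⊕ V)).ncard :=
        (Set.ncard_image_of_injective _ Sum.inl_injective).symm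
      _ ≤ S.ncard := Set.ncard_le_ncard (Set.image_preimage_subset _ _) (Set.toFinite _)
  have houter : outer.ncard ≤ 1 :=
    Set.ncard_le_one_iff_subsingleton.2 (G.subsingleton_components_not_subset A S)
  have hle : K.oddComponents.ncard ≤ inner.ncard + outer.ncard := by
    refine (Set.ncard_le_ncard (fun c hc => ?_) (Set.toFinite _)).trans
      (Set.ncard_union_le inner outer)
    by_cases hcA : ∀ v ∈ c.supp, (v : V ⊕ V) ∈ Sum.inl '' A
    exacts [Or.inl ⟨hc, hcA⟩, Or.inr hcA]
  have hparity : Odd K.oddComponents.ncard ↔ Odd S.ncard := by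
    rw [SimpleGraph.odd_ncard_oddComponents]
    have hcard : Nat.card ((⊤ : (G.cliqueExtension A).Subgraph).deleteVerts S).verts = Sᶜ.ncard := by
      rw [Nat.card_coe_set_eq, SimpleGraph.Subgraph.deleteVerts_verts,
        SimpleGraph.Subgraph.verts_top, Set.compl_eq_univ_sdiff]
    have hsum := Set.ncard_add_ncard_compl S
    rw [Nat.card_sum] at hsum
    rw [hcard]
    grind
  grind

/-- A Tutte-type condition: if for every vertex set `S` the number of odd components of
`G − S` all of whose vertices lie in `A` is at most `|S|`, then `G` has a matching
saturating `A`. -/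
theorem stmt_3 [Fintype V] (G : SimpleGraph V) (A : Set V)
    (h : ∀ S : Set V,
      {c : (G.induce Sᶜ).ConnectedComponent |
        Odd c.supp.ncard ∧ ∀ v ∈ c.supp, (v : V) ∈ A}.ncard ≤ S.ncard) :
    ∃ M : G.Subgraph, M.IsMatching ∧ A ⊆ M.verts := by
  obtain ⟨M, hM, hspan⟩ :=
    SimpleGraph.tutte.2 (G.not_isTutteViolator_cliqueExtension A h)
  let N : G.Subgraph :=
    { verts := {v | ∃ w, G.Adj v w ∧ M.Adj (Sum.inl v) (Sum.inl w)}
      Adj := fun v w => G.Adj v w ∧ M.Adj (Sum.inl v) (Sum.inl w)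
      adj_sub := fun h => h.1
      edge_vert := fun h => ⟨_, h⟩
      symm := ⟨fun _ _ h => ⟨h.1.symm, h.2.symm⟩⟩ }
  refine ⟨N, ?_, fun a ha => ?_⟩
  · rintro v ⟨w, hw⟩
    exact ⟨w, hw, fun y hy => Sum.inl_injective (hM.eq_of_adj_left hy.2 hw.2)⟩
  · obtain ⟨y, hy, -⟩ := hM (hspan (Sum.inl a))
    obtain ⟨b, rfl, hab⟩ := SimpleGraph.cliqueExtension_adj_of_mem ha hy.adj_sub
    exact ⟨b, hab, hy⟩
end

section
/- Let G be a finite simple graph with at least one edge. Then the following three statements are equivalent: (1) G has a matching that saturates core(G); (2) G has a mitigating set of cardinality es_Δ(G) which is a matching; (3) for every nonempty set S ⊆ core(G), es_Δ(G[N[S]]) ≤ |N[S]|/2, where G[N[S]] denotes the subgraph of G induced by the closed neighborhood N[S] of S. -/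
open SimpleGraph

attribute [local instance] Classical.propDecidable

universe u

variable {V : Type u}

/-- The core of `G`: the set of vertices of maximum degree. -/
def SimpleGraph.core [Fintype V] (G : SimpleGraph V) : Set V :=
  {v | G.degree v = G.maxDegree}

/-- The closed neighborhood of a set `S` of vertices. -/
def SimpleGraph.closedNbhd (G : SimpleGraph V) (S : Set V) : Set V :=
  S ∪ {w | ∃ v ∈ S, G.Adj v w}

/-- A set of edges of `G` *covers* a set `K` of vertices if every vertex of `K` is an endpoint of
one of these edges. -/
structure SimpleGraph.IsEdgeCoverOf (G : SimpleGraph V) (K : Set V) (F : Set (Sym2 V)) : Prop where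
  subset_edgeSet : F ⊆ G.edgeSet
  exists_mem : ∀ v ∈ K, ∃ e ∈ F, v ∈ e

/-- An edge cover of minimum cardinality. -/
structure SimpleGraph.IsMinEdgeCoverOf (G : SimpleGraph V) (K : Set V) (F : Set (Sym2 V)) : Prop
    extends G.IsEdgeCoverOf K F where
  ncard_le : ∀ F', G.IsEdgeCoverOf K F' → F.ncard ≤ F'.ncard

namespace SimpleGraph

lemma IsEdgeCoverOf.exists_isMinEdgeCoverOf {G : SimpleGraph V} {K : Set V} {F : Set (Sym2 V)}
    (hF : G.IsEdgeCoverOf K F) : ∃ F', G.IsMinEdgeCoverOf K F' := by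
  obtain ⟨F', hF', hmin⟩ := (measure (Set.ncard (α := Sym2 V))).wf.has_min
    {F | G.IsEdgeCoverOf K F} ⟨F, hF⟩
  exact ⟨F', hF', fun F'' h => not_lt.1 (hmin F'' h)⟩

lemma IsMinEdgeCoverOf.exists_endpoint_unique [Finite V] {G : SimpleGraph V} {K : Set V}
    {F : Set (Sym2 V)} (hF : G.IsMinEdgeCoverOf K F) {e : Sym2 V} (he : e ∈ F) :
    ∃ v ∈ K, v ∈ e ∧ ∀ e' ∈ F, v ∈ e' → e' = e := by
  by_contra! h
  refine (Set.ncard_sdiff_singleton_lt_of_mem he F.toFinite).not_ge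
    (hF.ncard_le _ ⟨Set.sdiff_subset.trans hF.subset_edgeSet, fun v hv => ?_⟩)
  obtain ⟨f, hf, hvf⟩ := hF.exists_mem v hv
  by_cases hfe : f = e
  · obtain ⟨e', he', hve', hne⟩ := h v hv (hfe ▸ hvf)
    exact ⟨e', ⟨he', hne⟩, hve'⟩
  · exact ⟨f, ⟨hf, hfe⟩, hvf⟩

lemma Subgraph.IsMatching.eq_of_mem_edgeSet {G : SimpleGraph V} {M : G.Subgraph}
    (hM : M.IsMatching) {v : V} {e f : Sym2 V} (he : e ∈ M.edgeSet) (hf : f ∈ M.edgeSet)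
    (hve : v ∈ e) (hvf : v ∈ f) : e = f := by
  obtain ⟨a, rfl⟩ := Sym2.mem_iff_exists.1 hve
  obtain ⟨b, rfl⟩ := Sym2.mem_iff_exists.1 hvf
  exact congrArg _ (hM.eq_of_adj_left he hf)

/-- A set of pairwise non-adjacent edges is the edge set of a matching. -/
lemma exists_isMatching_edgeSet_eq {G : SimpleGraph V} {F : Set (Sym2 V)} (hF : F ⊆ G.edgeSet)
    (h : ∀ v, ∀ e ∈ F, ∀ f ∈ F, v ∈ e → v ∈ f → e = f) :
    ∃ M : G.Subgraph, M.IsMatching ∧ M.edgeSet = F := by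
  let M : G.Subgraph :=
    { verts := {v | ∃ e ∈ F, v ∈ e}
      Adj a b := s(a, b) ∈ F
      adj_sub hab := hF hab
      edge_vert {a b} hab := ⟨s(a, b), hab, Sym2.mem_mk_left a b⟩
      symm := ⟨fun a b hab => by rwa [Sym2.eq_swap]⟩ }
  refine ⟨M, ?_, ?_⟩
  · rintro v ⟨e, he, hve⟩
    obtain ⟨w, rfl⟩ := Sym2.mem_iff_exists.1 hve
    exact ⟨w, he, fun w' hw' =>
      Sym2.congr_right.1 (h v _ hw' _ he (Sym2.mem_mk_left _ _) (Sym2.mem_mk_left _ _))⟩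
  · ext e
    induction e with | _ a b => rfl

lemma Subgraph.IsMatching.isEdgeCoverOf {G : SimpleGraph V} {M : G.Subgraph} (hM : M.IsMatching)
    {K : Set V} (hK : K ⊆ M.verts) : G.IsEdgeCoverOf K M.edgeSet := by
  refine ⟨M.edgeSet_subset, fun v hv => ?_⟩
  obtain ⟨w, hw, -⟩ := hM (hK hv)
  exact ⟨s(v, w), hw, Sym2.mem_mk_left _ _⟩

lemma IsEdgeCoverOf.subset_verts {G : SimpleGraph V} {M : G.Subgraph} {K : Set V}
    (h : G.IsEdgeCoverOf K M.edgeSet) : K ⊆ M.verts := by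
  intro v hv
  obtain ⟨e, he, hve⟩ := h.exists_mem v hv
  exact M.mem_verts_of_mem_edge he hve

/-- If some matching saturates `K`, then some edge cover of `K` of minimum cardinality is a
matching: take one which shares as many edges as possible with the given matching. -/
lemma Subgraph.IsMatching.exists_isMinEdgeCoverOf [Finite V] {G : SimpleGraph V} {M : G.Subgraph}
    (hM : M.IsMatching) {K : Set V} (hK : K ⊆ M.verts) :
    ∃ N : G.Subgraph, N.IsMatching ∧ G.IsMinEdgeCoverOf K N.edgeSet := by
  obtain ⟨F, hF, hmax⟩ := Set.exists_max_image {F | G.IsMinEdgeCoverOf K F}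
    (fun F => (F ∩ M.edgeSet).ncard) (Set.toFinite _)
    (hM.isEdgeCoverOf hK).exists_isMinEdgeCoverOf
  have hF : G.IsMinEdgeCoverOf K F := hF
  suffices h : ∀ v, ∀ e ∈ F, ∀ f ∈ F, v ∈ e → v ∈ f → e = f by
    obtain ⟨N, hN, rfl⟩ := exists_isMatching_edgeSet_eq hF.subset_edgeSet h
    exact ⟨N, hN, hF⟩
  -- An edge outside the matching which meets another edge of the cover can be exchanged.
  have exchange : ∀ v, ∀ e ∈ F, ∀ f ∈ F, v ∈ e → v ∈ f → e ≠ f → e ∈ M.edgeSet := by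
    intro c e he f hf hce hcf hne
    by_contra heM
    obtain ⟨x, hxK, hxe, hx⟩ := hF.exists_endpoint_unique he
    obtain ⟨y, hxy, -⟩ := hM (hK hxK)
    have hcx : c ≠ x := by
      rintro rfl
      exact hne (hx f hf hcf).symm
    have hec : e = s(c, x) := (Sym2.mem_and_mem_iff hcx).1 ⟨hce, hxe⟩
    have hgF : s(x, y) ∉ F := fun hg => heM (hx _ hg (Sym2.mem_mk_left _ _) ▸ hxy)
    have hcard : (insert s(x, y) (F \ {e})).ncard = F.ncard := by
      rw [Set.ncard_insert_of_notMem (fun h => hgF h.1),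
        Set.ncard_sdiff_singleton_add_one he]
    have hcov : G.IsMinEdgeCoverOf K (insert s(x, y) (F \ {e})) := by
      refine ⟨⟨?_, fun v hv => ?_⟩, fun F' hF' => hcard ▸ hF.ncard_le F' hF'⟩
      · exact Set.insert_subset (M.edgeSet_subset hxy)
          (Set.sdiff_subset.trans hF.subset_edgeSet)
      · obtain ⟨g, hg, hvg⟩ := hF.exists_mem v hv
        by_cases hge : g = e
        · rw [hge, hec, Sym2.mem_iff] at hvg
          rcases hvg with rfl | rfl
          · exact ⟨f, Or.inr ⟨hf, hne.symm⟩, hcf⟩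
          · exact ⟨_, Or.inl rfl, Sym2.mem_mk_left _ _⟩
        · exact ⟨g, Or.inr ⟨hg, hge⟩, hvg⟩
    refine (hmax _ hcov).not_gt (Set.ncard_lt_ncard ⟨?_, fun h => ?_⟩)
    · rintro g ⟨hg, hgM⟩
      exact ⟨Or.inr ⟨hg, fun h => heM (h ▸ hgM)⟩, hgM⟩
    · exact hgF (h ⟨Or.inl rfl, hxy⟩).1
  intro v e he f hf hve hvf
  by_contra hne
  exact hne (hM.eq_of_mem_edgeSet (exchange v e he f hf hve hvf hne)
    (exchange v f hf e he hvf hve (Ne.symm hne)) hve hvf)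

/-! ### Mitigating sets and edge covers of the core -/

variable [Fintype V]

lemma degree_deleteEdges_lt {G : SimpleGraph V} {F : Set (Sym2 V)} (hF : F ⊆ G.edgeSet) {v : V}
    (hv : ∃ e ∈ F, v ∈ e) : (G.deleteEdges F).degree v < G.degree v := by
  obtain ⟨e, he, hve⟩ := hv
  obtain ⟨w, rfl⟩ := Sym2.mem_iff_exists.1 hve
  rw [← card_neighborFinset_eq_degree, ← card_neighborFinset_eq_degree]
  refine Finset.card_lt_card ⟨fun u hu => ?_, fun h => ?_⟩
  · simp only [mem_neighborFinset, deleteEdges_adj] at hu ⊢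
    exact hu.1
  · have := h ((G.mem_neighborFinset v w).2 (hF he))
    simp only [mem_neighborFinset, deleteEdges_adj] at this
    exact this.2 he

lemma le_degree_deleteEdges_add_one {G : SimpleGraph V} {F : Set (Sym2 V)} {v : V} {e : Sym2 V}
    (hv : ∀ e' ∈ F, v ∈ e' → e' = e) : G.degree v ≤ (G.deleteEdges F).degree v + 1 := by
  rw [← card_neighborFinset_eq_degree, ← card_neighborFinset_eq_degree]
  by_cases hve : ∃ w, e = s(v, w)
  · obtain ⟨w, rfl⟩ := hve
    refine (Finset.card_le_card (t := insert w ((G.deleteEdges F).neighborFinset v))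
      fun u hu => ?_).trans (Finset.card_insert_le _ _)
    simp only [Finset.mem_insert, mem_neighborFinset, deleteEdges_adj] at hu ⊢
    by_cases huF : s(v, u) ∈ F
    · exact Or.inl (Sym2.congr_right.1 (hv _ huF (Sym2.mem_mk_left _ _)))
    · exact Or.inr ⟨hu, huF⟩
  · refine (Finset.card_le_card fun u hu => ?_).trans (Nat.le_succ _)
    simp only [mem_neighborFinset, deleteEdges_adj] at hu ⊢
    exact ⟨hu, fun huF => hve ⟨u, (hv _ huF (Sym2.mem_mk_left _ _)).symm⟩⟩

lemma maxDegree_pos_of_edgeSet_nonempty {G : SimpleGraph V} (hE : G.edgeSet.Nonempty) :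
    0 < G.maxDegree := by
  obtain ⟨e, he⟩ := hE
  induction e with | _ a b =>
  exact ((G.degree_pos_iff_exists_adj a).2 ⟨b, he⟩).trans_le (G.degree_le_maxDegree a)

lemma IsMitigating.isEdgeCoverOf_core {G : SimpleGraph V} (hG : 0 < G.maxDegree)
    {F : Set (Sym2 V)} (hF : G.IsMitigating F) : G.IsEdgeCoverOf G.core F := by
  refine ⟨hF.1, fun v hv => ?_⟩
  by_contra! h
  have hdeg : (G.deleteEdges F).degree v = G.degree v := by
    rw [← card_neighborFinset_eq_degree, ← card_neighborFinset_eq_degree]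
    congr 1
    ext u
    simp only [mem_neighborFinset, deleteEdges_adj, and_iff_left_iff_imp]
    exact fun _ hu => h _ hu (Sym2.mem_mk_left _ _)
  have h1 := (G.deleteEdges F).degree_le_maxDegree v
  have h2 : G.degree v = G.maxDegree := hv
  have h3 := hF.2
  omega

lemma isEdgeCoverOf_core_edgeSet {G : SimpleGraph V} (hG : 0 < G.maxDegree) :
    G.IsEdgeCoverOf G.core G.edgeSet := by
  refine ⟨subset_rfl, fun v hv => ?_⟩
  have hv : G.degree v = G.maxDegree := hv
  obtain ⟨w, hw⟩ := (G.degree_pos_iff_exists_adj v).1 (hv ▸ hG)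
  exact ⟨s(v, w), hw, Sym2.mem_mk_left _ _⟩

lemma IsMinEdgeCoverOf.isMitigating {G : SimpleGraph V} (hG : 0 < G.maxDegree)
    {F : Set (Sym2 V)} (hF : G.IsMinEdgeCoverOf G.core F) : G.IsMitigating F := by
  refine ⟨hF.subset_edgeSet, le_antisymm ?_ ?_⟩
  · refine maxDegree_le_of_forall_degree_le _ _ fun v => ?_
    have hle : (G.deleteEdges F).degree v ≤ G.degree v := by
      rw [← card_neighborFinset_eq_degree, ← card_neighborFinset_eq_degree]
      refine Finset.card_le_card fun u hu => ?_
      simp only [mem_neighborFinset, deleteEdges_adj] at hu ⊢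
      exact hu.1
    by_cases hv : v ∈ G.core
    · have := degree_deleteEdges_lt hF.subset_edgeSet (hF.exists_mem v hv)
      have := G.degree_le_maxDegree v
      omega
    · have := (G.degree_le_maxDegree v).lt_of_ne hv
      omega
  · have : Nonempty V := by
      by_contra h
      rw [not_nonempty_iff] at h
      simp at hG
    obtain ⟨u, hu⟩ := G.exists_maximal_degree_vertex
    obtain ⟨e, he, -⟩ := hF.exists_mem u hu.symm
    obtain ⟨v, hv, -, hve⟩ := hF.exists_endpoint_unique he
    have h1 := le_degree_deleteEdges_add_one (G := G) hve
    have h2 := (G.deleteEdges F).degree_le_maxDegree v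
    have h3 : G.degree v = G.maxDegree := hv
    omega

lemma IsMinEdgeCoverOf.ncard_eq_esDelta {G : SimpleGraph V} (hG : 0 < G.maxDegree)
    {F : Set (Sym2 V)} (hF : G.IsMinEdgeCoverOf G.core F) : F.ncard = G.esDelta := by
  refine le_antisymm ?_ (Nat.sInf_le ⟨F, hF.isMitigating hG, rfl⟩)
  obtain ⟨S, hS, hcard⟩ := Nat.sInf_mem (s := {n | ∃ S : Set (Sym2 V), G.IsMitigating S ∧
    S.ncard = n}) ⟨_, F, hF.isMitigating hG, rfl⟩
  exact (hF.ncard_le S (hS.isEdgeCoverOf_core hG)).trans_eq hcard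

theorem exists_saturating_iff_exists_minimum_mitigating {G : SimpleGraph V}
    (hE : G.edgeSet.Nonempty) :
    (∃ M : G.Subgraph, M.IsMatching ∧ G.core ⊆ M.verts) ↔
      ∃ M : G.Subgraph, M.IsMatching ∧ G.IsMitigating M.edgeSet ∧
        M.edgeSet.ncard = G.esDelta := by
  have hG := maxDegree_pos_of_edgeSet_nonempty hE
  refine ⟨fun ⟨M, hM, hsat⟩ => ?_, fun ⟨M, hM, hmit, _⟩ =>
    ⟨M, hM, (hmit.isEdgeCoverOf_core hG).subset_verts⟩⟩
  obtain ⟨N, hN, hcov⟩ := hM.exists_isMinEdgeCoverOf hsat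
  exact ⟨N, hN, hcov.isMitigating hG, hcov.ncard_eq_esDelta hG⟩

/-! ### The bound on induced closed neighbourhoods -/

lemma IsEdgeCoverOf.esDelta_le {G : SimpleGraph V} (hG : 0 < G.maxDegree) {F : Set (Sym2 V)}
    (hF : G.IsEdgeCoverOf G.core F) : G.esDelta ≤ F.ncard := by
  obtain ⟨F', hF'⟩ := hF.exists_isMinEdgeCoverOf
  exact (hF'.ncard_eq_esDelta hG).symm.trans_le (hF'.ncard_le F hF)

lemma exists_isEdgeCoverOf_core_ncard_eq_esDelta {G : SimpleGraph V} (hG : 0 < G.maxDegree) :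
    ∃ F, G.IsEdgeCoverOf G.core F ∧ F.ncard = G.esDelta := by
  obtain ⟨F, hF⟩ := (isEdgeCoverOf_core_edgeSet hG).exists_isMinEdgeCoverOf
  exact ⟨F, hF.toIsEdgeCoverOf, hF.ncard_eq_esDelta hG⟩

lemma Subgraph.IsMatching.two_mul_ncard_edgeSet_le {G : SimpleGraph V} {M : G.Subgraph}
    (hM : M.IsMatching) : 2 * M.edgeSet.ncard ≤ Nat.card V := by
  have hsum := M.spanningCoe.sum_degrees_eq_twice_card_edges
  have hcard : M.spanningCoe.edgeFinset.card = M.edgeSet.ncard := by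
    rw [← Set.ncard_coe_finset, coe_edgeFinset, Subgraph.edgeSet_spanningCoe]
  rw [← hcard, ← hsum, Nat.card_eq_fintype_card, ← Finset.card_univ, Finset.card_eq_sum_ones]
  refine Finset.sum_le_sum fun v _ => ?_
  rw [← card_neighborFinset_eq_degree, Finset.card_le_one]
  intro a ha b hb
  rw [mem_neighborFinset, Subgraph.spanningCoe_adj] at ha hb
  exact hM.eq_of_adj_left ha hb

lemma ncard_neighborSet {V : Type*} (G : SimpleGraph V) (v : V) [Fintype (G.neighborSet v)] :
    (G.neighborSet v).ncard = G.degree v := by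
  rw [← card_neighborFinset_eq_degree, ← Set.ncard_coe_finset, coe_neighborFinset]

lemma degree_induce_eq_ncard (G : SimpleGraph V) (N : Set V) (v : N) :
    (G.induce N).degree v = (G.neighborSet v ∩ N).ncard := by
  rw [← ncard_neighborSet, ← Set.ncard_image_of_injective _ Subtype.val_injective]
  congr 1
  ext w
  simp [and_comm]

lemma degree_induce_le_maxDegree (G : SimpleGraph V) (N : Set V) (v : N) :
    (G.induce N).degree v ≤ G.maxDegree := by
  rw [degree_induce_eq_ncard]
  exact (Set.ncard_le_ncard Set.inter_subset_left).trans
    ((G.ncard_neighborSet v).trans_le (G.degree_le_maxDegree v))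

lemma degree_induce_closedNbhd (G : SimpleGraph V) {S : Set V} {v : V} (hv : v ∈ S) :
    (G.induce (G.closedNbhd S)).degree ⟨v, Or.inl hv⟩ = G.degree v := by
  rw [degree_induce_eq_ncard, ← ncard_neighborSet, Set.inter_eq_left.2]
  exact fun w hw => Or.inr ⟨v, hv, hw⟩

lemma maxDegree_induce_closedNbhd {G : SimpleGraph V} {S : Set V} (hS : S.Nonempty)
    (hcore : S ⊆ G.core) : (G.induce (G.closedNbhd S)).maxDegree = G.maxDegree := by
  obtain ⟨v, hv⟩ := hS
  refine le_antisymm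
    (maxDegree_le_of_forall_degree_le _ _ (G.degree_induce_le_maxDegree _)) ?_
  have h1 := (G.induce (G.closedNbhd S)).degree_le_maxDegree ⟨v, Or.inl hv⟩
  have h2 : G.degree v = G.maxDegree := hcore hv
  rwa [degree_induce_closedNbhd G hv, h2] at h1

lemma Subgraph.IsMatching.two_mul_esDelta_induce_closedNbhd_le {G : SimpleGraph V}
    {M : G.Subgraph} (hM : M.IsMatching) (hsat : G.core ⊆ M.verts) (hG : 0 < G.maxDegree)
    {S : Set V} (hS : S.Nonempty) (hcore : S ⊆ G.core) :
    2 * (G.induce (G.closedNbhd S)).esDelta ≤ (G.closedNbhd S).ncard := by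
  have hmax := maxDegree_induce_closedNbhd hS hcore
  set N := G.closedNbhd S
  set F : Set (Sym2 N) := {e | e.map Subtype.val ∈ M.edgeSet}
  have hsub : F ⊆ (G.induce N).edgeSet := by
    intro e he
    induction e with | _ a b =>
    exact M.adj_sub he
  obtain ⟨M', hM', hM'F⟩ := exists_isMatching_edgeSet_eq hsub fun v e he f hf hve hvf =>
    Sym2.map.injective Subtype.val_injective (hM.eq_of_mem_edgeSet he hf
      (Sym2.mem_map.2 ⟨v, hve, rfl⟩) (Sym2.mem_map.2 ⟨v, hvf, rfl⟩))
  have hcov : (G.induce N).IsEdgeCoverOf (G.induce N).core F := by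
    refine ⟨hsub, fun v hv => ?_⟩
    have hv : (G.induce N).degree v = (G.induce N).maxDegree := hv
    rw [hmax, degree_induce_eq_ncard] at hv
    have hle : (G.neighborSet v).ncard ≤ (G.neighborSet v ∩ N).ncard := by
      rw [hv, ncard_neighborSet]
      exact G.degree_le_maxDegree v
    have hinter := Set.eq_of_subset_of_ncard_le Set.inter_subset_left hle
    rw [hinter, ncard_neighborSet] at hv
    obtain ⟨w, hw, -⟩ := hM (hsat hv)
    have hwN : w ∈ N := (hinter.symm.subset (M.adj_sub hw)).2
    exact ⟨s(v, ⟨w, hwN⟩), hw, Sym2.mem_mk_left _ _⟩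
  calc 2 * (G.induce N).esDelta ≤ 2 * M'.edgeSet.ncard := by
        rw [hM'F]
        exact Nat.mul_le_mul_left _ (hcov.esDelta_le (hmax ▸ hG))
    _ ≤ Nat.card N := hM'.two_mul_ncard_edgeSet_le
    _ = N.ncard := Nat.card_coe_set_eq N

lemma IsEdgeCoverOf.ncard_le_two_mul {G : SimpleGraph V} {K : Set V} {F : Set (Sym2 V)}
    (hF : G.IsEdgeCoverOf K F) : K.ncard ≤ 2 * F.ncard := by
  have hsub : K.toFinset ⊆ F.toFinset.biUnion Sym2.toFinset := fun v hv => by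
    simpa using hF.exists_mem v (by simpa using hv)
  have := (Finset.card_le_card hsub).trans
    (Finset.card_biUnion_le_card_mul _ _ 2 fun e _ => by
      rw [Sym2.card_toFinset]; split_ifs <;> norm_num)
  rwa [← Set.ncard_eq_toFinset_card', ← Set.ncard_eq_toFinset_card', mul_comm] at this

/-- An edge cover of many disjoint odd sets, with few neighbours outside these sets, is large. -/
lemma IsEdgeCoverOf.ncard_iUnion_add_card_le {G : SimpleGraph V} {ι : Type*} [Finite ι]
    {C : ι → Set V} {T : Set V} {F : Set (Sym2 V)} (hF : G.IsEdgeCoverOf (⋃ i, C i) F)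
    (hdisj : Pairwise fun i j => Disjoint (C i) (C j)) (hT : ∀ i, Disjoint (C i) T)
    (hodd : ∀ i, Odd (C i).ncard) (hadj : ∀ i, ∀ a ∈ C i, ∀ b, G.Adj a b → b ∈ C i ∪ T) :
    (⋃ i, C i).ncard + Nat.card ι ≤ 2 * F.ncard := by
  cases nonempty_fintype ι
  set D : ι → Set (Sym2 V) := fun i => {e ∈ F | ∃ v ∈ C i, v ∈ e}
  have hD : ∀ i, (C i).ncard + 1 ≤ 2 * (D i).ncard := fun i => by
    have hcov : G.IsEdgeCoverOf (C i) (D i) := by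
      refine ⟨(Set.sep_subset _ _).trans hF.subset_edgeSet, fun v hv => ?_⟩
      obtain ⟨e, he, hve⟩ := hF.exists_mem v (Set.mem_iUnion.2 ⟨i, hv⟩)
      exact ⟨e, ⟨he, v, hv, hve⟩, hve⟩
    obtain ⟨k, hk⟩ := hodd i
    have := hcov.ncard_le_two_mul
    omega
  have hDdisj : Pairwise fun i j => Disjoint (D i) (D j) := by
    intro i j hij
    refine Set.disjoint_left.2 ?_
    rintro e ⟨he, v, hv, hve⟩ ⟨-, w, hw, hwe⟩
    have hvw : v ≠ w := fun h => Set.disjoint_left.1 (hdisj hij) hv (h ▸ hw)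
    have hadj' : G.Adj v w :=
      hF.subset_edgeSet ((Sym2.mem_and_mem_iff hvw).1 ⟨hve, hwe⟩ ▸ he)
    rcases hadj i v hv w hadj' with h | h
    · exact Set.disjoint_left.1 (hdisj hij) h hw
    · exact Set.disjoint_left.1 (hT j) hw h
  have hFD : ∑ i, (D i).ncard ≤ F.ncard := by
    rw [← finsum_eq_sum_of_fintype, ← Set.ncard_iUnion_of_finite (fun _ => Set.toFinite _) hDdisj]
    exact Set.ncard_le_ncard (Set.iUnion_subset fun i => Set.sep_subset _ _)
  have hCS : (⋃ i, C i).ncard = ∑ i, (C i).ncard := by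
    rw [← finsum_eq_sum_of_fintype, ← Set.ncard_iUnion_of_finite (fun _ => Set.toFinite _) hdisj]
  calc (⋃ i, C i).ncard + Nat.card ι = ∑ i, ((C i).ncard + 1) := by
        simp [hCS, Finset.sum_add_distrib]
    _ ≤ ∑ i, 2 * (D i).ncard := Finset.sum_le_sum fun i _ => hD i
    _ ≤ 2 * F.ncard := by
        rw [← Finset.mul_sum]
        exact Nat.mul_le_mul_left _ hFD

/-- The graph obtained from `G` by adding a copy of `V` and making all vertices, other than those
of `K`, pairwise adjacent. Its perfect matchings correspond to the matchings of `G` which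
saturate `K`. -/
def cliqueOutside {V : Type*} (G : SimpleGraph V) (K : Set V) : SimpleGraph (V ⊕ V) where
  Adj x y := x ≠ y ∧ ((x ∉ Sum.inl '' K ∧ y ∉ Sum.inl '' K) ∨
    ∃ a b, G.Adj a b ∧ x = Sum.inl a ∧ y = Sum.inl b)
  symm := ⟨fun _ _ ⟨hne, h⟩ => ⟨hne.symm, h.imp And.symm
    fun ⟨a, b, hab, ha, hb⟩ => ⟨b, a, hab.symm, hb, ha⟩⟩⟩
  loopless := ⟨fun _ h => h.1 rfl⟩

lemma Subgraph.IsPerfectMatching.exists_isMatching_of_cliqueOutside {V : Type*}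
    {G : SimpleGraph V} {K : Set V} {M : (G.cliqueOutside K).Subgraph}
    (hM : M.IsPerfectMatching) : ∃ N : G.Subgraph, N.IsMatching ∧ K ⊆ N.verts := by
  obtain ⟨N, hN, hNF⟩ := exists_isMatching_edgeSet_eq (G := G)
    (F := {e ∈ G.edgeSet | e.map Sum.inl ∈ M.edgeSet}) (Set.sep_subset _ _)
    fun v e he f hf hve hvf => Sym2.map.injective Sum.inl_injective
      (hM.1.eq_of_mem_edgeSet he.2 hf.2 (Sym2.mem_map.2 ⟨v, hve, rfl⟩)
        (Sym2.mem_map.2 ⟨v, hvf, rfl⟩))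
  refine ⟨N, hN, fun v hv => ?_⟩
  obtain ⟨y, hy, -⟩ := hM.1 (hM.2 (Sum.inl v))
  obtain ⟨-, ⟨h, -⟩ | ⟨a, b, hab, ha, rfl⟩⟩ := M.adj_sub hy
  · exact absurd ⟨v, hv, rfl⟩ h
  · obtain rfl := Sum.inl_injective ha
    have hvb : s(v, b) ∈ N.edgeSet := hNF ▸ ⟨hab, hy⟩
    exact N.edge_vert hvb

/-- **Tutte's theorem** for matchings saturating a prescribed set `K` of vertices. -/
lemma exists_odd_sets_of_forall_not_saturating {V : Type u} [Finite V] {G : SimpleGraph V}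
    {K : Set V} (h : ¬∃ M : G.Subgraph, M.IsMatching ∧ K ⊆ M.verts) :
    ∃ (ι : Type u) (_ : Finite ι) (C : ι → Set V) (T : Set V), (∀ i, C i ⊆ K) ∧
      (Pairwise fun i j => Disjoint (C i) (C j)) ∧ (∀ i, Disjoint (C i) T) ∧
      (∀ i, Odd (C i).ncard) ∧ (∀ i, ∀ a ∈ C i, ∀ b, G.Adj a b → b ∈ C i ∪ T) ∧
      T.ncard < Nat.card ι := by
  set G' := G.cliqueOutside K
  obtain ⟨U, hU⟩ : ∃ U, G'.IsTutteViolator U := by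
    by_contra! hU
    obtain ⟨M, hM⟩ := tutte.2 hU
    exact h hM.exists_isMatching_of_cliqueOutside
  set D := ((⊤ : G'.Subgraph).deleteVerts U).coe with hD
  have hverts : ∀ x, x ∈ ((⊤ : G'.Subgraph).deleteVerts U).verts ↔ x ∉ U := by simp
  have hDadj : ∀ x y : ((⊤ : G'.Subgraph).deleteVerts U).verts, G'.Adj x y → D.Adj x y := by
    intro x y hxy
    simpa [hD, hxy] using ⟨(hverts _).1 x.2, (hverts _).1 y.2⟩
  have hparity : U.ncard + 1 < D.oddComponents.ncard := by
    have hodd := D.odd_ncard_oddComponents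
    have hcard : Nat.card ((⊤ : G'.Subgraph).deleteVerts U).verts + U.ncard = 2 * Nat.card V := by
      have : ((⊤ : G'.Subgraph).deleteVerts U).verts = Uᶜ := by ext x; simp
      rw [Nat.card_coe_set_eq, this, add_comm, Set.ncard_add_ncard_compl, Nat.card_sum, two_mul]
    have hU : U.ncard < D.oddComponents.ncard := hU
    rw [Nat.odd_iff, Nat.odd_iff] at hodd
    omega
  set B : Set D.ConnectedComponent := {c | ∃ x ∈ c.supp, x.1 ∉ Sum.inl '' K}
  have hB : B.ncard ≤ 1 := by
    refine (Set.ncard_le_one_iff).2 ?_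
    rintro c d ⟨x, rfl, hx⟩ ⟨y, rfl, hy⟩
    by_cases hxy : x = y
    · rw [hxy]
    · exact ConnectedComponent.sound
        (hDadj x y ⟨fun h => hxy (Subtype.ext h), Or.inl ⟨hx, hy⟩⟩).reachable
  have hcount : U.ncard < (D.oddComponents \ B).ncard := by
    have := Set.ncard_le_ncard_sdiff_add_ncard D.oddComponents B
    omega
  have hK : ∀ c : ↥(D.oddComponents \ B), Subtype.val '' c.1.supp ⊆ Sum.inl '' K := by
    rintro c _ ⟨x, hx, rfl⟩
    by_contra hxK
    exact c.2.2 ⟨x, hx, hxK⟩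
  refine ⟨↥(D.oddComponents \ B), inferInstance,
    fun c => Sum.inl ⁻¹' (Subtype.val '' c.1.supp), Sum.inl ⁻¹' U, ?_, ?_, ?_, ?_, ?_, ?_⟩
  · intro c a ha
    obtain ⟨b, hb, hab⟩ := hK c ha
    exact Sum.inl_injective hab ▸ hb
  · intro c d hcd
    refine Disjoint.preimage _ ((Set.disjoint_image_iff Subtype.val_injective).2 ?_)
    exact D.pairwise_disjoint_supp_connectedComponent (Subtype.val_injective.ne hcd)
  · intro c
    refine Disjoint.preimage _ (Set.disjoint_left.2 ?_)
    rintro _ ⟨x, -, rfl⟩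
    exact (hverts _).1 x.2
  · intro c
    rw [Set.ncard_preimage_of_injective_subset_range Sum.inl_injective
      ((hK c).trans (Set.image_subset_range _ _)),
      Set.ncard_image_of_injective _ Subtype.val_injective]
    exact c.2.1
  · rintro c a ⟨x, hx, hxa⟩ b hab
    by_cases hb : Sum.inl b ∈ U
    · exact Or.inr hb
    · have hxb : D.Adj x ⟨Sum.inl b, (hverts _).2 hb⟩ :=
        hDadj _ _ ⟨by simpa [hxa] using hab.ne, Or.inr ⟨a, b, hab, hxa, rfl⟩⟩
      exact Or.inl ⟨_, (c.1.mem_supp_congr_adj hxb).1 hx, rfl⟩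
  · rw [Nat.card_coe_set_eq]
    refine lt_of_le_of_lt ?_ hcount
    rw [← Set.ncard_image_of_injective _ (Sum.inl_injective (α := V) (β := V))]
    exact Set.ncard_le_ncard (Set.image_preimage_subset _ _)

lemma exists_isMatching_of_forall_two_mul_esDelta_le {G : SimpleGraph V} (hG : 0 < G.maxDegree)
    (h : ∀ S : Set V, S.Nonempty → S ⊆ G.core →
      2 * (G.induce (G.closedNbhd S)).esDelta ≤ (G.closedNbhd S).ncard) :
    ∃ M : G.Subgraph, M.IsMatching ∧ G.core ⊆ M.verts := by
  by_contra hM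
  obtain ⟨ι, _, C, T, hCK, hdisj, hT, hodd, hadj, hcard⟩ :=
    exists_odd_sets_of_forall_not_saturating hM
  set S := ⋃ i, C i with hS
  have hne : S.Nonempty := by
    have : Nonempty ι := (Nat.card_pos_iff.1 (Nat.zero_lt_of_lt hcard)).1
    obtain ⟨i⟩ := this
    exact (Set.nonempty_of_ncard_ne_zero (hodd i).pos.ne').mono (Set.subset_iUnion C i)
  have hcore : S ⊆ G.core := Set.iUnion_subset hCK
  have hmax := maxDegree_induce_closedNbhd hne hcore
  have hN : (G.closedNbhd S).ncard ≤ S.ncard + T.ncard := by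
    refine (Set.ncard_le_ncard (t := S ∪ T) ?_).trans (Set.ncard_union_le S T)
    rintro w (hw | ⟨v, hv, hvw⟩)
    · exact Or.inl hw
    · obtain ⟨i, hi⟩ := Set.mem_iUnion.1 hv
      exact (hadj i v hi w hvw).imp_left fun h => Set.mem_iUnion.2 ⟨i, h⟩
  obtain ⟨F, hF, hFcard⟩ := exists_isEdgeCoverOf_core_ncard_eq_esDelta (hmax ▸ hG)
  have hcov : G.IsEdgeCoverOf S (Sym2.map Subtype.val '' F) := by
    refine ⟨?_, fun v hv => ?_⟩
    · rintro _ ⟨e, he, rfl⟩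
      have := hF.subset_edgeSet he
      induction e with | _ a b => exact this
    · have hvcore : G.degree v = G.maxDegree := hcore hv
      obtain ⟨e, he, hve⟩ := hF.exists_mem ⟨v, Or.inl hv⟩
        ((degree_induce_closedNbhd G hv).trans (hvcore.trans hmax.symm))
      exact ⟨_, ⟨e, he, rfl⟩, Sym2.mem_map.2 ⟨_, hve, rfl⟩⟩
  have h1 := hcov.ncard_iUnion_add_card_le hdisj hT hodd hadj
  rw [Set.ncard_image_of_injective _ (Sym2.map.injective Subtype.val_injective), hFcard,
    ← hS] at h1
  have h2 := h S hne hcore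
  omega

end SimpleGraph

/-- Characterization of graphs having a minimum mitigating set which is a matching:
(1) there is a matching saturating the core, iff (2) there is a minimum mitigating set
which is a matching, iff (3) for every nonempty `S ⊆ core(G)`,
`es_Δ(G[N[S]]) ≤ |N[S]|/2`. -/
theorem stmt_4 [Fintype V] (G : SimpleGraph V) (hE : G.edgeSet.Nonempty) :
    ((∃ M : G.Subgraph, M.IsMatching ∧ G.core ⊆ M.verts) ↔
      (∃ M : G.Subgraph, M.IsMatching ∧ G.IsMitigating M.edgeSet ∧
        M.edgeSet.ncard = G.esDelta)) ∧
    ((∃ M : G.Subgraph, M.IsMatching ∧ G.core ⊆ M.verts) ↔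
      (∀ S : Set V, S.Nonempty → S ⊆ G.core →
        ((G.induce (G.closedNbhd S)).esDelta : ℝ) ≤ (G.closedNbhd S).ncard / 2)) := by
  have hG := maxDegree_pos_of_edgeSet_nonempty hE
  have hcast : ∀ m n : ℕ, (m : ℝ) ≤ n / 2 ↔ 2 * m ≤ n := fun m n => by
    rw [le_div_iff₀ two_pos, mul_comm]
    exact_mod_cast Iff.rfl
  simp only [hcast]
  exact ⟨exists_saturating_iff_exists_minimum_mitigating hE,
    fun ⟨_, hM, hsat⟩ _ hS hcore => hM.two_mul_esDelta_induce_closedNbhd_le hsat hG hS hcore,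
    exists_isMatching_of_forall_two_mul_esDelta_le hG⟩
end

section
/- Let Δ ≥ 1 be an integer and let c be a real constant with 0 < c < 1 such that es_Δ(H) ≤ c·|V(H)| holds for every Δ-regular finite simple graph H. Then es_Δ(G) ≤ c·|V(G)| holds for every finite simple graph G with Δ(G) = Δ. -/
open SimpleGraph

attribute [local instance] Classical.propDecidable

universe u

variable {V : Type u}

/-- Restoring one deleted edge raises the maximum degree by at most one. -/
lemma SimpleGraph.maxDegree_deleteEdges_diff_singleton_le [Fintype V] (G : SimpleGraph V)
    (T : Set (Sym2 V)) (e : Sym2 V) :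
    (G.deleteEdges (T \ {e})).maxDegree ≤ (G.deleteEdges T).maxDegree + 1 := by
  refine maxDegree_le_of_forall_degree_le _ _ fun v => ?_
  by_cases hv : ∃ w, s(v, w) = e
  · obtain ⟨w, rfl⟩ := hv
    have hsub : (G.deleteEdges (T \ {s(v, w)})).neighborFinset v ⊆
        insert w ((G.deleteEdges T).neighborFinset v) := by
      intro x hx
      simp only [mem_neighborFinset, deleteEdges_adj, Finset.mem_insert, Set.mem_sdiff,
        Set.mem_singleton_iff] at hx ⊢
      by_cases hxw : x = w
      · exact Or.inl hxw
      · refine Or.inr ⟨hx.1, fun hT => hx.2 ⟨hT, fun h => hxw (Sym2.congr_right.mp h)⟩⟩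
    have h₁ := (Finset.card_le_card hsub).trans (Finset.card_insert_le _ _)
    simp only [card_neighborFinset_eq_degree] at h₁
    exact h₁.trans (Nat.add_le_add_right (degree_le_maxDegree _ v) 1)
  · have hsub : (G.deleteEdges (T \ {e})).neighborFinset v ⊆
        (G.deleteEdges T).neighborFinset v := by
      intro x hx
      simp only [mem_neighborFinset, deleteEdges_adj, Set.mem_sdiff,
        Set.mem_singleton_iff] at hx ⊢
      exact ⟨hx.1, fun hT => hx.2 ⟨hT, fun h => hv ⟨x, h⟩⟩⟩
    have h₁ := Finset.card_le_card hsub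
    simp only [card_neighborFinset_eq_degree] at h₁
    exact (h₁.trans (degree_le_maxDegree _ v)).trans (Nat.le_succ _)

/-- A set of edges whose removal lowers the maximum degree contains a mitigating set. -/
lemma SimpleGraph.exists_isMitigating_subset_s6 [Fintype V] (G : SimpleGraph V) (T : Set (Sym2 V))
    (hT : (G.deleteEdges T).maxDegree < G.maxDegree) : ∃ S ⊆ T, G.IsMitigating S := by
  induction hn : T.ncard using Nat.strong_induction_on generalizing T with
  | _ n ih =>
    by_cases hmit : G.IsMitigating T
    · exact ⟨T, subset_rfl, hmit⟩
    obtain ⟨e, he, hlt⟩ : ∃ e ∈ T, (G.deleteEdges (T \ {e})).maxDegree < G.maxDegree := by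
      by_cases hsub : T ⊆ G.edgeSet
      · have hne : (G.deleteEdges T).maxDegree ≠ G.maxDegree - 1 := fun h => hmit ⟨hsub, h⟩
        have hT' : T.Nonempty := by
          by_contra h
          rw [Set.not_nonempty_iff_eq_empty] at h
          subst h
          simp at hT
        obtain ⟨e, he⟩ := hT'
        refine ⟨e, he, ?_⟩
        have := G.maxDegree_deleteEdges_diff_singleton_le T e
        omega
      · obtain ⟨e, he, heG⟩ := Set.not_subset.mp hsub
        refine ⟨e, he, ?_⟩
        have heq : G.deleteEdges (T \ {e}) = G.deleteEdges T := by
          ext v w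
          simp only [deleteEdges_adj, Set.mem_sdiff, Set.mem_singleton_iff]
          refine and_congr_right fun h => not_congr ⟨And.left, fun h' => ⟨h', ?_⟩⟩
          rintro rfl
          exact heG h
        simpa only [heq] using hT
    have hcard : (T \ {e}).ncard < n := hn ▸ Set.ncard_sdiff_singleton_lt_of_mem he (Set.toFinite T)
    obtain ⟨S, hS, hmS⟩ := ih _ hcard (T \ {e}) (by convert hlt) rfl
    exact ⟨S, hS.trans Set.sdiff_subset, hmS⟩

lemma SimpleGraph.esDelta_le_ncard [Fintype V] (G : SimpleGraph V) (T : Set (Sym2 V))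
    (hT : (G.deleteEdges T).maxDegree < G.maxDegree) : G.esDelta ≤ T.ncard := by
  obtain ⟨S, hS, hmS⟩ := G.exists_isMitigating_subset_s6 T hT
  have hle : G.esDelta ≤ S.ncard := Nat.sInf_le ⟨S, hmS, rfl⟩
  exact hle.trans (Set.ncard_le_ncard hS (Set.toFinite T))

lemma SimpleGraph.exists_isMitigating_ncard_eq_esDelta [Fintype V] (G : SimpleGraph V)
    (hG : 0 < G.maxDegree) : ∃ S, G.IsMitigating S ∧ S.ncard = G.esDelta := by
  refine Nat.sInf_mem (s := {n | ∃ S : Set (Sym2 V), G.IsMitigating S ∧ S.ncard = n}) ?_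
  obtain ⟨S, -, hS⟩ := G.exists_isMitigating_subset_s6 G.edgeSet (by
    refine lt_of_le_of_lt (maxDegree_le_of_forall_degree_le _ 0 fun v => ?_) hG
    rw [Nat.le_zero, ← card_neighborFinset_eq_degree, Finset.card_eq_zero]
    ext w
    simp)
  exact ⟨_, S, hS, rfl⟩

/-- Two disjoint copies of `G`, in which the two copies of each vertex of less than maximum
degree are joined by an edge. -/
def SimpleGraph.deficientDouble [Fintype V] (G : SimpleGraph V) : SimpleGraph (V × Bool) where
  Adj x y := (G.Adj x.1 y.1 ∧ x.2 = y.2) ∨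
    (x.1 = y.1 ∧ x.2 ≠ y.2 ∧ G.degree x.1 < G.maxDegree)
  symm := ⟨by
    rintro x y (⟨h, h'⟩ | ⟨h, h', h''⟩)
    · exact Or.inl ⟨h.symm, h'.symm⟩
    · exact Or.inr ⟨h.symm, h'.symm, h ▸ h''⟩⟩
  loopless := ⟨by
    rintro x (⟨h, -⟩ | ⟨-, h, -⟩)
    · exact G.irrefl h
    · exact h rfl⟩

lemma SimpleGraph.degree_deficientDouble [Fintype V] (G : SimpleGraph V) (v : V) (b : Bool) :
    G.deficientDouble.degree (v, b) =
      G.degree v + if G.degree v < G.maxDegree then 1 else 0 := by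
  have h : G.deficientDouble.neighborFinset (v, b) =
      (G.neighborFinset v).image (fun w => (w, b)) ∪
        if G.degree v < G.maxDegree then {(v, !b)} else ∅ := by
    ext ⟨w, b'⟩
    rw [mem_neighborFinset]
    split_ifs with hlt <;> cases b <;> cases b' <;> simp [deficientDouble, hlt, eq_comm]
  rw [← card_neighborFinset_eq_degree, h, Finset.card_union_of_disjoint,
    Finset.card_image_of_injective _ (Prod.mk_left_injective b), card_neighborFinset_eq_degree]
  · split_ifs <;> simp
  · split_ifs
    · simp
    · simp

lemma SimpleGraph.maxDegree_deficientDouble [Fintype V] (G : SimpleGraph V) :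
    G.deficientDouble.maxDegree = G.maxDegree := by
  apply le_antisymm
  · refine maxDegree_le_of_forall_degree_le _ _ fun x => ?_
    have := G.degree_le_maxDegree x.1
    rw [show x = (x.1, x.2) from rfl, degree_deficientDouble]
    split_ifs <;> omega
  · refine maxDegree_le_of_forall_degree_le _ _ fun v => ?_
    have := G.deficientDouble.degree_le_maxDegree (v, true)
    rw [degree_deficientDouble] at this
    omega

lemma SimpleGraph.maxDegree_deleteEdges_preimage_le [Fintype V] (G : SimpleGraph V)
    (S : Set (Sym2 (V × Bool))) (b : Bool) :
    (G.deleteEdges (Sym2.map (fun v => (v, b)) ⁻¹' S)).maxDegree ≤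
      (G.deficientDouble.deleteEdges S).maxDegree := by
  refine maxDegree_le_of_forall_degree_le _ _ fun v => ?_
  refine le_trans ?_ (degree_le_maxDegree _ (v, b))
  rw [← card_neighborFinset_eq_degree, ← card_neighborFinset_eq_degree]
  refine Finset.card_le_card_of_injOn (fun w => (w, b)) ?_ (Prod.mk_left_injective b).injOn
  intro w hw
  simp only [Finset.mem_coe, mem_neighborFinset, deleteEdges_adj, Set.mem_preimage,
    Sym2.map_mk] at hw ⊢
  exact ⟨Or.inl ⟨hw.1, rfl⟩, hw.2⟩

lemma ncard_preimage_add_ncard_preimage_le [Fintype V] (S : Set (Sym2 (V × Bool))) :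
    (Sym2.map (fun v : V => (v, false)) ⁻¹' S).ncard +
      (Sym2.map (fun v : V => (v, true)) ⁻¹' S).ncard ≤ S.ncard := by
  have hinj (b : Bool) : Function.Injective (Sym2.map (fun v : V => (v, b))) :=
    Sym2.map.injective (Prod.mk_left_injective b)
  rw [← Set.ncard_image_of_injective _ (hinj false), ← Set.ncard_image_of_injective _ (hinj true),
    ← Set.ncard_union_eq ?_ (Set.toFinite _) (Set.toFinite _)]
  · exact Set.ncard_le_ncard (Set.union_subset (Set.image_preimage_subset _ _)
      (Set.image_preimage_subset _ _)) (Set.toFinite _)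
  · rw [Set.disjoint_left]
    rintro _ ⟨e, -, rfl⟩ ⟨e', -, h⟩
    induction e with
    | _ x y =>
      induction e' with
      | _ x' y' => simp at h

lemma SimpleGraph.two_mul_esDelta_le [Fintype V] (G : SimpleGraph V) (hG : 0 < G.maxDegree) :
    2 * G.esDelta ≤ G.deficientDouble.esDelta := by
  obtain ⟨S, hS, hcard⟩ := G.deficientDouble.exists_isMitigating_ncard_eq_esDelta
    (by rwa [maxDegree_deficientDouble])
  have hle (b : Bool) : G.esDelta ≤ (Sym2.map (fun v : V => (v, b)) ⁻¹' S).ncard := by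
    refine G.esDelta_le_ncard _ ((G.maxDegree_deleteEdges_preimage_le S b).trans_lt ?_)
    have h : (G.deficientDouble.deleteEdges S).maxDegree = G.deficientDouble.maxDegree - 1 := by
      convert hS.2
    rw [h, maxDegree_deficientDouble]
    omega
  have := ncard_preimage_add_ncard_preimage_le S
  have := hle false
  have := hle true
  omega

/-- Reduction to regular graphs: if `es_Δ(H) ≤ c·|V(H)|` for every `Δ`-regular graph `H`,
then `es_Δ(G) ≤ c·|V(G)|` for every graph `G` with `Δ(G) = Δ`. -/
theorem stmt_6 {Δ : ℕ} (hΔ : 1 ≤ Δ) {c : ℝ} (hc0 : 0 < c) (hc1 : c < 1)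
    (hreg : ∀ (W : Type u) [Fintype W] (H : SimpleGraph W),
      H.IsRegularOfDegree Δ → (H.esDelta : ℝ) ≤ c * Fintype.card W)
    [Fintype V] (G : SimpleGraph V) (hG : G.maxDegree = Δ) :
    (G.esDelta : ℝ) ≤ c * Fintype.card V := by
  obtain ⟨n, hn⟩ : ∃ n, ∀ v, Δ ≤ G.degree v + n := ⟨Δ, fun v => Nat.le_add_left _ _⟩
  induction n generalizing V with
  | zero =>
    exact hreg V G fun v => le_antisymm (hG ▸ G.degree_le_maxDegree v) (hn v)
  | succ n ih =>
    have h := ih G.deficientDouble (by rw [maxDegree_deficientDouble, hG]) (by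
      rintro ⟨v, b⟩
      have := hn v
      rw [degree_deficientDouble]
      split_ifs <;> omega)
    have h₂ : (2 * G.esDelta : ℝ) ≤ G.deficientDouble.esDelta := by
      exact_mod_cast G.two_mul_esDelta_le (by omega)
    rw [Fintype.card_prod, Fintype.card_bool] at h
    push_cast at h
    linarith
end

section
/- Let G be a finite simple graph of order n that contains an odd cycle, and let 2k+1 (k ≥ 1) be the odd girth of G, i.e., the length of a shortest odd cycle of G. Then es_Δ(G) ≤ ((k+1)/(2k+1))·n. -/
open SimpleGraph

attribute [local instance] Classical.propDecidable

universe u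

variable {V : Type u}

open Finset in
/-- A family of edges covering every vertex of maximum degree contains a mitigating set. -/
theorem SimpleGraph.esDelta_le_card_of_cover [Fintype V] [Nonempty V] (G : SimpleGraph V)
    (S : Finset (Sym2 V)) (hS : ∀ e ∈ S, e ∈ G.edgeSet)
    (hcov : ∀ v, G.degree v = G.maxDegree → ∃ e ∈ S, v ∈ e) : G.esDelta ≤ S.card := by
  obtain ⟨T, hTS, hT⟩ := exists_minimal_le_of_wellFoundedLT
    (fun T : Finset (Sym2 V) => ∀ v, G.degree v = G.maxDegree → ∃ e ∈ T, v ∈ e) S hcov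
  have hTE : ∀ e ∈ T, e ∈ G.edgeSet := fun e he => hS e (hTS he)
  suffices h : G.IsMitigating (T : Set (Sym2 V)) by
    have hle : G.esDelta ≤ T.card := Nat.sInf_le ⟨_, h, Set.ncard_coe_finset T⟩
    exact hle.trans (card_le_card hTS)
  refine ⟨hTE, ?_⟩
  suffices key : ∀ (H : SimpleGraph V) (_ : DecidableRel H.Adj),
      (∀ u v, H.Adj u v ↔ G.Adj u v ∧ s(u, v) ∉ T) → H.maxDegree = G.maxDegree - 1 from
    key _ _ fun u v => by simp [deleteEdges_adj]
  intro H _ hadj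
  apply le_antisymm
  · apply maxDegree_le_of_forall_degree_le
    intro v
    apply Nat.le_sub_one_of_lt
    by_cases hv : G.degree v = G.maxDegree
    · obtain ⟨e, he, hve⟩ := hT.prop v hv
      obtain ⟨u, rfl⟩ := Sym2.mem_iff_exists.mp hve
      rw [← hv]
      apply card_lt_card
      rw [ssubset_iff_of_subset]
      · exact ⟨u, by simpa using hTE _ he, by simp [hadj, he]⟩
      · intro w hw
        rw [mem_neighborFinset, hadj] at hw
        simpa using hw.1
    · refine lt_of_le_of_lt ?_ (lt_of_le_of_ne (G.degree_le_maxDegree v) hv)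
      apply card_le_card
      intro w hw
      rw [mem_neighborFinset, hadj] at hw
      simpa using hw.1
  · obtain ⟨x, hx⟩ := G.exists_maximal_degree_vertex
    obtain ⟨e, he, -⟩ := hT.prop x hx.symm
    have hnot := hT.not_prop_of_lt (erase_ssubset he)
    push Not at hnot
    obtain ⟨v, hv, hve⟩ := hnot
    have huniq : ∀ e' ∈ T, v ∈ e' → e' = e := fun e' he' hve' => by
      by_contra hne
      exact hve e' (mem_erase.mpr ⟨hne, he'⟩) hve'
    have hve : v ∈ e := by
      obtain ⟨e', he', hve'⟩ := hT.prop v hv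
      exact huniq e' he' hve' ▸ hve'
    obtain ⟨u, rfl⟩ := Sym2.mem_iff_exists.mp hve
    refine le_trans ?_ (H.degree_le_maxDegree v)
    rw [← hv]
    refine (pred_card_le_card_erase (a := u)).trans (card_le_card ?_)
    intro w hw
    rw [mem_erase, mem_neighborFinset] at hw
    rw [mem_neighborFinset, hadj]
    refine ⟨hw.2, fun hmem => hw.1 ?_⟩
    exact Sym2.congr_right.mp (huniq _ hmem (Sym2.mem_mk_left v w))

open Finset in
/-- The vertices of maximum degree can be matched injectively to neighbours. -/
theorem SimpleGraph.exists_injOn_adj_of_degree_eq_maxDegree_s7 [Fintype V] (G : SimpleGraph V)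
    (hG : 0 < G.maxDegree) :
    ∃ f : V → V, Set.InjOn f {v | G.degree v = G.maxDegree} ∧
      ∀ v, G.degree v = G.maxDegree → G.Adj v (f v) := by
  obtain ⟨g, hg, hadj⟩ := (all_card_le_biUnion_card_iff_exists_injective
    (fun v : {v // G.degree v = G.maxDegree} => G.neighborFinset v)).mp (by
      intro A
      refine Nat.le_of_mul_le_mul_right (card_mul_le_card_mul
        (fun (a : {v // G.degree v = G.maxDegree}) b => G.Adj a b) (m := G.maxDegree)
        (n := G.maxDegree) (fun a ha => ?_) (fun b _ => ?_)) hG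
      · refine a.2.ge.trans ?_
        apply card_le_card
        intro w hw
        rw [mem_bipartiteAbove, mem_biUnion]
        exact ⟨⟨a, ha, hw⟩, by simpa using hw⟩
      · refine le_trans ?_ (G.degree_le_maxDegree b)
        rw [← card_map (Function.Embedding.subtype _)]
        apply card_le_card
        intro w hw
        obtain ⟨a, ha, rfl⟩ := mem_map.mp hw
        rw [mem_bipartiteBelow] at ha
        simpa using ha.2.symm)
  refine ⟨fun v => if h : G.degree v = G.maxDegree then g ⟨v, h⟩ else v, ?_, ?_⟩
  · intro u (hu : G.degree u = G.maxDegree) v (hv : G.degree v = G.maxDegree) huv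
    simpa [hu, hv, hg.eq_iff] using huv
  · intro v hv
    simpa [hv] using hadj ⟨v, hv⟩

theorem SimpleGraph.exists_walk_iterate (G : SimpleGraph V) (f : V → V) (v : V)
    (h : ∀ i, G.Adj (f^[i] v) (f^[i + 1] v)) (n : ℕ) :
    ∃ p : G.Walk v (f^[n] v), p.length = n ∧
      p.support = (List.range (n + 1)).map (fun i => f^[i] v) := by
  induction n with
  | zero => exact ⟨Walk.nil, by simp⟩
  | succ n ih =>
    obtain ⟨p, hp, hs⟩ := ih
    refine ⟨p.concat (h n), (Walk.length_concat _ _).trans (by rw [hp]), ?_⟩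
    rw [Walk.support_concat, hs, List.range_succ (n := n + 1)]
    simp

/-- An orbit of length at least three along adjacent vertices is a cycle. -/
theorem SimpleGraph.exists_isCycle_minimalPeriod (G : SimpleGraph V) (f : V → V) (v : V)
    (h : ∀ i, G.Adj (f^[i] v) (f^[i + 1] v)) (hl : 3 ≤ Function.minimalPeriod f v) :
    ∃ (u : V) (w : G.Walk u u), w.IsCycle ∧ w.length = Function.minimalPeriod f v := by
  obtain ⟨n, hn⟩ : ∃ n, Function.minimalPeriod f v = n + 1 :=
    ⟨_, (Nat.sub_add_cancel (by omega)).symm⟩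
  obtain ⟨p, hp, hs⟩ := G.exists_walk_iterate f v h n
  have hlast : G.Adj (f^[n] v) v := by
    have := h n
    rwa [← hn, Function.iterate_minimalPeriod] at this
  refine ⟨_, Walk.cons hlast p, ?_, by simp [hp, hn]⟩
  rw [Walk.isCycle_iff_isPath_tail_and_le_length]
  refine ⟨?_, by simp; omega⟩
  simp only [Walk.isPath_def, Walk.support_tail_of_not_nil _ Walk.not_nil_cons, Walk.support_cons,
    List.tail_cons]
  rw [hs]
  refine List.Nodup.map_on ?_ List.nodup_range
  intro i hi j hj hij
  rw [List.mem_range] at hi hj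
  exact Function.iterate_injOn_Iio_minimalPeriod (by simp; omega) (by simp; omega) hij

open Finset in
/-- If every odd cycle has length at least `2k+1` and `f` maps `M` injectively to neighbours, then
`W ∩ M` can be covered by `((k+1)/(2k+1))·|W|` edges for each `W` closed under `f` on `M`. -/
theorem SimpleGraph.exists_edge_cover_of_injOn (G : SimpleGraph V) (k : ℕ)
    (hmin : ∀ (v : V) (w : G.Walk v v), w.IsCycle → Odd w.length → 2 * k + 1 ≤ w.length)
    (f : V → V) (M : Set V) (hinj : Set.InjOn f M) (hadj : ∀ v ∈ M, G.Adj v (f v))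
    (W : Finset V) (hW : ∀ v ∈ W, v ∈ M → f v ∈ W) :
    ∃ S : Finset (Sym2 V), (∀ e ∈ S, e ∈ G.edgeSet) ∧ (∀ v ∈ W, v ∈ M → ∃ e ∈ S, v ∈ e) ∧
      (2 * k + 1) * S.card ≤ (k + 1) * W.card := by
  induction W using Finset.strongInduction with
  | H W ih =>
  have step : ∀ (A : Finset V) (T : Finset (Sym2 V)), A ⊆ W → A.Nonempty →
      (∀ v ∈ W, v ∈ M → v ∉ A → f v ∉ A) → (∀ e ∈ T, e ∈ G.edgeSet) →
      (∀ v ∈ A, v ∈ M → ∃ e ∈ T, v ∈ e) → (2 * k + 1) * T.card ≤ (k + 1) * A.card →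
      ∃ S : Finset (Sym2 V), (∀ e ∈ S, e ∈ G.edgeSet) ∧ (∀ v ∈ W, v ∈ M → ∃ e ∈ S, v ∈ e) ∧
        (2 * k + 1) * S.card ≤ (k + 1) * W.card := by
    intro A T hAW hA hcl hTE hTc hTcard
    obtain ⟨S, hSE, hSc, hScard⟩ := ih (W \ A) (sdiff_ssubset hAW hA) (by
      intro v hv hvM
      rw [mem_sdiff] at hv ⊢
      exact ⟨hW v hv.1 hvM, hcl v hv.1 hvM hv.2⟩)
    refine ⟨T ∪ S, fun e he => (mem_union.mp he).elim (hTE e) (hSE e), ?_, ?_⟩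
    · intro v hv hvM
      by_cases hvA : v ∈ A
      · obtain ⟨e, he, hve⟩ := hTc v hvA hvM
        exact ⟨e, mem_union_left _ he, hve⟩
      · obtain ⟨e, he, hve⟩ := hSc v (mem_sdiff.mpr ⟨hv, hvA⟩) hvM
        exact ⟨e, mem_union_right _ he, hve⟩
    · calc (2 * k + 1) * (T ∪ S).card ≤ (2 * k + 1) * (T.card + S.card) :=
            Nat.mul_le_mul_left _ (card_union_le T S)
        _ ≤ (k + 1) * (A.card + (W \ A).card) := by linarith
        _ = (k + 1) * W.card := by rw [add_comm A.card, card_sdiff_add_card_eq_card hAW]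
  rcases W.eq_empty_or_nonempty with rfl | ⟨v, hv⟩
  · exact ⟨∅, by simp⟩
  by_cases hsurj : ∀ v ∈ W, ∃ u ∈ W, u ∈ M ∧ f u = v
  · have hWM : ∀ u ∈ W, u ∈ M := by
      have himg : W ⊆ (W.filter (· ∈ M)).image f := by
        intro v hv
        obtain ⟨u, hu, huM, rfl⟩ := hsurj v hv
        exact mem_image_of_mem f (mem_filter.mpr ⟨hu, huM⟩)
      exact filter_card_eq ((card_filter_le _ _).antisymm
        ((card_le_card himg).trans card_image_le))
    have hit : ∀ i, f^[i] v ∈ W := by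
      intro i
      induction i with
      | zero => exact hv
      | succ i hi =>
        rw [Function.iterate_succ_apply']
        exact hW _ hi (hWM _ hi)
    have hadj' : ∀ i, G.Adj (f^[i] v) (f^[i + 1] v) := by
      intro i
      rw [Function.iterate_succ_apply']
      exact hadj _ (hWM _ (hit i))
    have hper : v ∈ Function.periodicPts f := by
      have hmaps : Set.MapsTo f (W : Set V) W := fun u hu => hW u hu (hWM u hu)
      obtain ⟨i, j, hij, heq⟩ : ∃ i j, i < j ∧ f^[i] v = f^[j] v := by
        obtain ⟨i, j, hne, heq⟩ := Finite.exists_ne_map_eq_of_infinite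
          (fun i : ℕ => (⟨f^[i] v, hit i⟩ : W))
        rw [Subtype.mk.injEq] at heq
        rcases hne.lt_or_gt with h | h
        · exact ⟨i, j, h, heq⟩
        · exact ⟨j, i, h, heq.symm⟩
      refine ⟨j - i, by omega, ?_⟩
      have hinjW : Set.InjOn f (W : Set V) := hinj.mono (fun u hu => hWM u hu)
      refine (hinjW.iterate hmaps i) (hit (j - i)) hv ?_
      rw [← Function.iterate_add_apply, heq]
      congr 2
      omega
    set l := Function.minimalPeriod f v with hl
    have hlpos : 0 < l := Function.minimalPeriod_pos_of_mem_periodicPts hper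
    have hmem : ∀ i, f^[i] v ∈ (range l).image (fun i => f^[i] v) := fun i =>
      mem_image.mpr ⟨i % l, mem_range.mpr (Nat.mod_lt _ hlpos),
        Function.iterate_mod_minimalPeriod_eq⟩
    have hcard : ((range l).image (fun i => f^[i] v)).card = l := by
      rw [card_image_of_injOn, card_range]
      intro i hi j hj hij
      exact Function.iterate_injOn_Iio_minimalPeriod (by simpa using hi) (by simpa using hj) hij
    refine step ((range l).image (fun i => f^[i] v))
      ((range ((l + 1) / 2)).image (fun i => s(f^[2 * i] v, f^[2 * i + 1] v)))
      ?_ ⟨v, hmem 0⟩ ?_ ?_ ?_ ?_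
    · intro u hu
      obtain ⟨i, -, rfl⟩ := mem_image.mp hu
      exact hit i
    · intro u hu huM huA hfu
      obtain ⟨i, -, hi⟩ := mem_image.mp hfu
      have hi' : f (f^[i + l - 1] v) = f u := by
        rw [← hi, ← Function.iterate_succ_apply' f, Nat.sub_one, Nat.succ_pred (by omega),
          Function.iterate_add_apply, Function.iterate_minimalPeriod]
      exact huA (hinj (hWM _ (hit _)) huM hi' ▸ hmem _)
    · intro e he
      obtain ⟨i, -, rfl⟩ := mem_image.mp he
      exact hadj' (2 * i)
    · intro u hu _
      obtain ⟨i, hi, rfl⟩ := mem_image.mp hu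
      rw [mem_range] at hi
      refine ⟨_, mem_image_of_mem _ (mem_range.mpr (show i / 2 < (l + 1) / 2 by omega)), ?_⟩
      rw [Sym2.mem_iff]
      rcases Nat.even_or_odd' i with ⟨j, rfl | rfl⟩
      · left
        congr 2
        omega
      · right
        congr 2
        omega
    · rw [hcard]
      refine (Nat.mul_le_mul_left _ card_image_le).trans ?_
      rw [card_range]
      rcases Nat.even_or_odd' l with ⟨j, hj | hj⟩
      · rw [show (l + 1) / 2 = j by omega, hj]
        nlinarith
      · have hl1 : l ≠ 1 := fun h => (hadj' 0).ne (by
          have := Function.iterate_minimalPeriod (f := f) (x := v)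
          rw [← hl, h] at this
          exact this.symm)
        obtain ⟨u, w, hw, hwl⟩ := G.exists_isCycle_minimalPeriod f v hadj' (by omega)
        have := hmin u w hw (hwl ▸ ⟨j, hj⟩)
        rw [show (l + 1) / 2 = j + 1 by omega, hj]
        nlinarith
  · push Not at hsurj
    obtain ⟨v, hv, hvf⟩ := hsurj
    by_cases hvM : v ∈ M
    · have hne := (hadj v hvM).ne
      refine step {v, f v} {s(v, f v)} ?_ ⟨v, by simp⟩ ?_ ?_ ?_ ?_
      · simp [insert_subset_iff, hv, hW v hv hvM]
      · intro u hu huM huA hfu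
        rw [mem_insert, mem_singleton] at hfu
        rcases hfu with h | h
        · exact hvf u hu huM h
        · exact huA (by simp [hinj huM hvM h])
      · simpa using hadj v hvM
      · intro u hu _
        simpa using hu
      · rw [card_pair hne, card_singleton]
        omega
    · refine step {v} ∅ (by simpa using hv) ⟨v, by simp⟩ ?_ (by simp) ?_ (by simp)
      · intro u hu huM _ hfu
        exact hvf u hu huM (by simpa using hfu)
      · intro u hu huM
        rw [mem_singleton] at hu
        exact absurd (hu ▸ huM) hvM

/-- If `G` has odd girth `2k+1` (`k ≥ 1`), then `es_Δ(G) ≤ ((k+1)/(2k+1))·n`. -/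
theorem stmt_7 [Fintype V] (G : SimpleGraph V) (k : ℕ) (hk : 1 ≤ k)
    (hcyc : ∃ (v : V) (w : G.Walk v v), w.IsCycle ∧ w.length = 2 * k + 1)
    (hmin : ∀ (v : V) (w : G.Walk v v), w.IsCycle → Odd w.length → 2 * k + 1 ≤ w.length) :
    (G.esDelta : ℝ) ≤ ((k : ℝ) + 1) / (2 * k + 1) * Fintype.card V := by
  obtain ⟨v, w, hw, -⟩ := hcyc
  have : Nonempty V := ⟨v⟩
  have hG : 0 < G.maxDegree := by
    rw [Nat.pos_iff_ne_zero, Ne, maxDegree_eq_zero_iff]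
    rintro rfl
    exact (Walk.adj_snd hw.not_nil).elim
  obtain ⟨f, hinj, hadj⟩ := G.exists_injOn_adj_of_degree_eq_maxDegree_s7 hG
  obtain ⟨S, hSE, hScov, hScard⟩ := G.exists_edge_cover_of_injOn k hmin f
    {v | G.degree v = G.maxDegree} hinj hadj Finset.univ (fun _ _ _ => Finset.mem_univ _)
  have hle := G.esDelta_le_card_of_cover S hSE (fun v hv => hScov v (Finset.mem_univ v) hv)
  have hmul : (2 * k + 1) * G.esDelta ≤ (k + 1) * Fintype.card V :=
    (Nat.mul_le_mul_left _ hle).trans hScard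
  rw [div_mul_eq_mul_div, le_div_iff₀ (by positivity), mul_comm]
  exact_mod_cast hmul
end

section
/- Let G be a finite simple graph which is not regular, and let G⁽¹⁾ be the graph obtained from two disjoint copies G′ and G″ of G by adding, for each vertex v of G with degree d_G(v) < Δ(G), an edge joining the copy of v in G′ to the copy of v in G″. If G⁽¹⁾ contains an odd cycle of length ℓ, then G contains an odd cycle of length at most ℓ. In particular, if G contains an odd cycle then og(G⁽¹⁾) ≥ og(G), and if G is bipartite then G⁽¹⁾ is bipartite. -/
open SimpleGraph

attribute [local instance] Classical.propDecidable

universe u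

variable {V : Type u}

/-- The graph `G⁽¹⁾` built from two disjoint copies of `G` by joining the two copies of
each vertex of non-maximum degree by an edge. -/
noncomputable def SimpleGraph.regStep [Fintype V] (G : SimpleGraph V) :
    SimpleGraph (V ⊕ V) :=
  SimpleGraph.fromRel (fun x y =>
    match x, y with
    | Sum.inl u, Sum.inl v => G.Adj u v
    | Sum.inr u, Sum.inr v => G.Adj u v
    | Sum.inl u, Sum.inr v => u = v ∧ G.degree u < G.maxDegree
    | Sum.inr _, Sum.inl _ => False)

/-- `m` is the odd girth of a graph `H`: `m` is odd, `H` has a cycle of length `m`, and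
every odd cycle of `H` has length at least `m`. -/
def SimpleGraph.OddGirthIs {W : Type u} (H : SimpleGraph W) (m : ℕ) : Prop :=
  Odd m ∧ (∃ (v : W) (w : H.Walk v v), w.IsCycle ∧ w.length = m) ∧
    ∀ (v : W) (w : H.Walk v v), w.IsCycle → Odd w.length → m ≤ w.length

namespace SimpleGraph

variable {G : SimpleGraph V}

/-- A walk either yields an odd cycle which is at most as long, or can be shortened to a path
with the same endpoints and length of the same parity. -/
theorem Walk.exists_odd_isCycle_or_isPath {u v : V} (p : G.Walk u v) :
    (∃ (x : V) (c : G.Walk x x), c.IsCycle ∧ Odd c.length ∧ c.length ≤ p.length) ∨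
      ∃ q : G.Walk u v, q.IsPath ∧ q.length ≤ p.length ∧ (Odd q.length ↔ Odd p.length) := by
  induction p with
  | nil => exact Or.inr ⟨Walk.nil, by simp⟩
  | @cons u v w h p ih =>
    rcases ih with ⟨x, c, hc, ho, hl⟩ | ⟨q, hq, hl, ho⟩
    · exact Or.inl ⟨x, c, hc, ho, hl.trans (by simp)⟩
    by_cases hu : u ∈ q.support
    · have hlen : (q.takeUntil u hu).length + (q.dropUntil u hu).length = q.length := by
        rw [← Walk.length_append, Walk.take_spec]
      rcases Nat.even_or_odd (q.takeUntil u hu).length with ht | ht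
      · refine Or.inl ⟨u, Walk.cons h (q.takeUntil u hu), ?_, ?_, ?_⟩
        · refine (Walk.cons_isCycle_iff _ h).mpr ⟨hq.takeUntil hu, fun he => ?_⟩
          rw [Sym2.eq_swap] at he
          rw [(hq.takeUntil hu).length_eq_one_of_mem_edges he] at ht
          exact absurd ht (by decide)
        · rw [Walk.length_cons]
          exact ht.add_one
        · simp only [Walk.length_cons]
          lia
      · refine Or.inr ⟨q.dropUntil u hu, hq.dropUntil hu, ?_, ?_⟩
        · simp only [Walk.length_cons]
          lia
        · simp only [Walk.length_cons]
          grind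
    · refine Or.inr ⟨Walk.cons h q, hq.cons hu, ?_, ?_⟩
      · simpa using hl
      · simp only [Walk.length_cons]
        grind

theorem Walk.exists_odd_isCycle_of_odd_length {v : V} (p : G.Walk v v) (hp : Odd p.length) :
    ∃ (x : V) (c : G.Walk x x), c.IsCycle ∧ Odd c.length ∧ c.length ≤ p.length := by
  rcases p.exists_odd_isCycle_or_isPath with h | ⟨q, hq, -, ho⟩
  · exact h
  · rw [Walk.length_eq_zero_iff.mpr (Walk.isPath_iff_nil.mp hq)] at ho
    simp [hp] at ho

/-- The two kinds of edges of `G⁽¹⁾`, seen through the projection to `G`. -/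
theorem regStep_adj_elim [Fintype V] {x y : V ⊕ V} (h : G.regStep.Adj x y) :
    (x.isLeft = y.isLeft ∧ G.Adj (x.elim id id) (y.elim id id)) ∨
      (x.isLeft ≠ y.isLeft ∧ x.elim id id = y.elim id id) := by
  rcases x with u | u <;> rcases y with v | v <;>
    simp only [regStep, fromRel_adj] at h <;> simp <;> grind [G.adj_comm]

/-- Projecting a walk of `G⁽¹⁾` to `G` removes exactly the edges between the two copies. -/
theorem regStep_exists_walk [Fintype V] {x y : V ⊕ V} (w : G.regStep.Walk x y) :
    ∃ q : G.Walk (x.elim id id) (y.elim id id), q.length ≤ w.length ∧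
      ((Odd q.length ↔ Odd w.length) ↔ x.isLeft = y.isLeft) := by
  induction w with
  | nil => exact ⟨Walk.nil, by simp⟩
  | @cons x y z h w ih =>
    obtain ⟨q, hl, ho⟩ := ih
    rcases regStep_adj_elim h with ⟨hs, ha⟩ | ⟨hs, he⟩
    · refine ⟨Walk.cons ha q, by simpa using hl, ?_⟩
      rw [hs, ← ho]
      simp only [Walk.length_cons]
      grind
    · refine ⟨q.copy he.symm rfl, ?_, ?_⟩
      · simp only [Walk.length_copy, Walk.length_cons]
        lia
      · have hxz : x.isLeft = z.isLeft ↔ ¬ y.isLeft = z.isLeft := by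
          revert hs
          cases x.isLeft <;> cases y.isLeft <;> cases z.isLeft <;> decide
        rw [hxz, ← ho]
        simp only [Walk.length_copy, Walk.length_cons]
        grind

theorem exists_odd_isCycle_of_regStep_walk [Fintype V] {x : V ⊕ V} (w : G.regStep.Walk x x)
    (hw : Odd w.length) :
    ∃ (v : V) (c : G.Walk v v), c.IsCycle ∧ Odd c.length ∧ c.length ≤ w.length := by
  obtain ⟨q, hl, ho⟩ := regStep_exists_walk w
  obtain ⟨v, c, hc, hodd, hle⟩ := q.exists_odd_isCycle_of_odd_length ((ho.mpr rfl).mpr hw)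
  exact ⟨v, c, hc, hodd, hle.trans hl⟩

end SimpleGraph

/-- If `G⁽¹⁾` has an odd cycle of length `ℓ`, then `G` has an odd cycle of length at
most `ℓ`; in particular its odd girth does not decrease, and bipartiteness is
preserved. -/
theorem stmt_8 [Fintype V] (G : SimpleGraph V)
    (hnotreg : ¬ ∃ k, G.IsRegularOfDegree k) :
    (∀ ℓ : ℕ, Odd ℓ →
      (∃ (x : V ⊕ V) (w : G.regStep.Walk x x), w.IsCycle ∧ w.length = ℓ) →
      ∃ (v : V) (w : G.Walk v v), w.IsCycle ∧ Odd w.length ∧ w.length ≤ ℓ) ∧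
    (∀ m m' : ℕ, G.OddGirthIs m → G.regStep.OddGirthIs m' → m ≤ m') ∧
    (G.Colorable 2 → G.regStep.Colorable 2) := by
  refine ⟨?_, ?_, ?_⟩
  · rintro ℓ hℓ ⟨x, w, -, rfl⟩
    exact exists_odd_isCycle_of_regStep_walk w hℓ
  · rintro m m' ⟨-, -, hmin⟩ ⟨hodd, ⟨x, w, -, rfl⟩, -⟩
    obtain ⟨v, c, hc, ho, hle⟩ := exists_odd_isCycle_of_regStep_walk w hodd
    exact (hmin v c hc ho).trans hle
  · rw [two_colorable_iff_forall_loop_even, two_colorable_iff_forall_loop_even]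
    intro h x w
    by_contra hw
    obtain ⟨v, c, -, ho, -⟩ :=
      exists_odd_isCycle_of_regStep_walk w (Nat.not_even_iff_odd.mp hw)
    exact Nat.not_even_iff_odd.mpr ho (h v c)
end

section
/- Let k ≥ 2 be an even integer and let G be a connected k-regular finite simple graph of order n. Then es_Δ(G) ≤ max{ (1 − (k² + 4)/(2(k² + k + 2)))·n , (n+1)/2 }. -/
open SimpleGraph

attribute [local instance] Classical.propDecidable

universe u

variable {V : Type u}

open SimpleGraph Finset in
/-- In a connected `k`-regular graph with `k` even, a nonempty set `C` of vertices all of whose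
outside neighbours lie in `S` sends many edges to `S`, or is large. -/
lemma SimpleGraph.IsRegularOfDegree.weighted_boundary_bound [Fintype V] {G : SimpleGraph V} {k : ℕ}
    (hk : 2 ≤ k) (hke : Even k) (hreg : G.IsRegularOfDegree k) (hconn : G.Connected)
    {S C : Finset V} (hS : S.Nonempty) (hC : C.Nonempty) (hdisj : Disjoint C S)
    (hN : ∀ v ∈ C, ∀ w, G.Adj v w → w ∈ C ∨ w ∈ S) :
    k ^ 2 + k + 2 ≤
      (k + 2) * ∑ v ∈ C, #(G.neighborFinset v ∩ S) + (k - 2) * #C := by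
  have hsplit : ∀ v ∈ C, #(G.neighborFinset v ∩ S) + #(G.neighborFinset v ∩ C) = k := by
    intro v hv
    rw [← hreg v, ← card_neighborFinset_eq_degree, ← card_union_of_disjoint,
      ← inter_union_distrib_left]
    · congr 1
      refine inter_eq_left.2 fun w hw => ?_
      have := hN v hv w (by simpa using hw)
      simp only [mem_union]; tauto
    · exact (hdisj.symm.mono inter_subset_right inter_subset_right)
  have hsum : ∑ v ∈ C, #(G.neighborFinset v ∩ S) + ∑ v ∈ C, #(G.neighborFinset v ∩ C)
      = #C * k := by
    rw [← sum_add_distrib, sum_congr rfl hsplit, sum_const, smul_eq_mul]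
  have heven : Even (∑ v ∈ C, #(G.neighborFinset v ∩ C)) := by
    let H : SimpleGraph V :=
      { Adj := fun a b => G.Adj a b ∧ a ∈ C ∧ b ∈ C
        symm := ⟨fun a b h => ⟨h.1.symm, h.2.2, h.2.1⟩⟩
        loopless := ⟨fun a h => G.irrefl h.1⟩ }
    have hdeg : ∑ v ∈ C, #(G.neighborFinset v ∩ C) = ∑ v, H.degree v := by
      rw [← sum_subset (subset_univ C)]
      · refine sum_congr rfl fun v hv => ?_
        rw [← card_neighborFinset_eq_degree]
        congr 1
        ext w
        simp [H, hv]
      · intro v _ hv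
        rw [← card_neighborFinset_eq_degree, card_eq_zero]
        ext w
        simp [H, hv]
    rw [hdeg, sum_degrees_eq_twice_card_edges]
    exact even_two_mul _
  have heven' : Even (∑ v ∈ C, #(G.neighborFinset v ∩ S)) := by
    have : Even (#C * k) := hke.mul_left _
    rw [← hsum, Nat.even_add] at this
    exact this.2 heven
  have hpos : 0 < ∑ v ∈ C, #(G.neighborFinset v ∩ S) := by
    obtain ⟨a, ha⟩ := hC
    obtain ⟨b, hb⟩ := hS
    obtain ⟨p⟩ := hconn.preconnected a b
    obtain ⟨e, -, he1, he2⟩ := p.exists_boundary_dart (C : Set V) (by simpa using ha)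
      (by simpa using (disjoint_right.1 hdisj hb))
    refine sum_pos' (fun _ _ => Nat.zero_le _) ⟨e.fst, he1, card_pos.2 ⟨e.snd, ?_⟩⟩
    have := hN _ he1 _ e.adj
    simp only [mem_inter, mem_neighborFinset]
    exact ⟨e.adj, this.resolve_left he2⟩
  have hcard : 0 < #C := card_pos.2 hC
  obtain ⟨j, rfl⟩ := Nat.exists_eq_add_of_le hk
  rw [Nat.add_sub_cancel_left]
  rcases Nat.lt_or_ge (2 + j) #C with hlarge | hsmall
  · have h2 : 2 ≤ ∑ v ∈ C, #(G.neighborFinset v ∩ S) := by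
      obtain ⟨r, hr⟩ := heven'
      omega
    nlinarith [Nat.mul_le_mul_left j hlarge, Nat.mul_le_mul_left (2 + j + 2) h2]
  · have hvert : ∀ v ∈ C, (2 + j + 1) - #C ≤ #(G.neighborFinset v ∩ S) := by
      intro v hv
      have h1 := hsplit v hv
      have h2 : #(G.neighborFinset v ∩ C) < #C := by
        refine card_lt_card ⟨inter_subset_right, fun h => ?_⟩
        simpa using h hv
      omega
    have h3 := card_nsmul_le_sum _ _ _ hvert
    rw [smul_eq_mul] at h3
    obtain ⟨t, ht⟩ := Nat.exists_eq_add_of_le hsmall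
    have h4 : 2 + j + 1 - #C = t + 1 := by omega
    rw [h4] at h3
    have h5 : 2 + j ≤ ∑ v ∈ C, #(G.neighborFinset v ∩ S) := by nlinarith
    nlinarith [Nat.mul_le_mul_left j hcard, Nat.mul_le_mul_left (2 + j + 2) h5]

open SimpleGraph Finset in
/-- A bound on the number of components left after deleting a nonempty set of vertices from a
connected regular graph of even degree. -/
lemma SimpleGraph.IsRegularOfDegree.card_connectedComponent_induce_compl_le [Fintype V]
    {G : SimpleGraph V} {k : ℕ} (hk : 2 ≤ k) (hke : Even k) (hreg : G.IsRegularOfDegree k)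
    (hconn : G.Connected) {S : Finset V} (hS : S.Nonempty) :
    (k ^ 2 + k + 2) * Nat.card (G.induce (S : Set V)ᶜ).ConnectedComponent ≤
      (k ^ 2 + k + 2) * #S + (k - 2) * Fintype.card V := by
  let K := (G.induce (S : Set V)ᶜ).ConnectedComponent
  let C : K → Finset V := fun c => c.supp.toFinset.map (Function.Embedding.subtype _)
  have hmem : ∀ (c : K) (v : V), v ∈ C c ↔
      ∃ h : v ∈ (S : Set V)ᶜ, (G.induce (S : Set V)ᶜ).connectedComponentMk ⟨v, h⟩ = c := by
    intro c v
    simp [C]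
  have hdS : ∀ c, Disjoint (C c) S := by
    intro c
    refine Finset.disjoint_left.2 fun v hv hvS => ?_
    obtain ⟨h, -⟩ := (hmem c v).1 hv
    exact h hvS
  have hbound : ∀ c : K, k ^ 2 + k + 2 ≤
      (k + 2) * ∑ v ∈ C c, #(G.neighborFinset v ∩ S) + (k - 2) * #(C c) := by
    intro c
    refine hreg.weighted_boundary_bound hk hke hconn hS ?_ (hdS c) ?_
    · obtain ⟨v, hv⟩ := c.nonempty_supp
      exact ⟨v, (hmem c v).2 ⟨v.2, hv⟩⟩
    · intro v hv w hvw
      obtain ⟨h, hc⟩ := (hmem c v).1 hv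
      by_cases hw : w ∈ S
      · exact Or.inr hw
      · refine Or.inl ((hmem c w).2 ⟨hw, ?_⟩)
        rw [← hc]
        refine ConnectedComponent.sound (Adj.reachable ?_)
        exact hvw.symm
  have hpd : (↑(univ : Finset K) : Set K).PairwiseDisjoint C := by
    intro c _ c' _ hne
    refine Finset.disjoint_left.2 fun v hv hv' => hne ?_
    obtain ⟨h, rfl⟩ := (hmem c v).1 hv
    obtain ⟨h', rfl⟩ := (hmem c' v).1 hv'
    rfl
  have hsub : univ.biUnion C ⊆ Sᶜ := by
    intro v hv
    obtain ⟨c, -, hc⟩ := mem_biUnion.1 hv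
    exact mem_compl.2 (Finset.disjoint_left.1 (hdS c) hc)
  have hsize : ∑ c, #(C c) + #S ≤ Fintype.card V := by
    rw [← card_biUnion hpd, ← card_compl_add_card S]
    exact Nat.add_le_add_right (card_le_card hsub) _
  have hedges : ∑ c, ∑ v ∈ C c, #(G.neighborFinset v ∩ S) ≤ k * #S := by
    rw [← sum_biUnion hpd]
    calc ∑ v ∈ univ.biUnion C, #(G.neighborFinset v ∩ S)
        ≤ ∑ v, #(G.neighborFinset v ∩ S) :=
          sum_le_sum_of_subset (subset_univ _)
      _ = ∑ v, #(bipartiteAbove G.Adj S v) := by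
          refine sum_congr rfl fun v _ => ?_
          congr 1
          ext w
          simp [bipartiteAbove, and_comm]
      _ = ∑ w ∈ S, #(bipartiteBelow G.Adj univ w) :=
          sum_card_bipartiteAbove_eq_sum_card_bipartiteBelow _
      _ = ∑ w ∈ S, k := by
          refine sum_congr rfl fun w _ => ?_
          rw [← hreg w, ← card_neighborFinset_eq_degree]
          congr 1
          ext v
          simp [bipartiteBelow, adj_comm]
      _ = k * #S := by rw [sum_const, smul_eq_mul, mul_comm]
  have htotal := sum_le_sum fun c (_ : c ∈ (univ : Finset K)) => hbound c
  rw [sum_const, sum_add_distrib, ← mul_sum, ← mul_sum, smul_eq_mul, card_univ] at htotal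
  rw [Nat.card_eq_fintype_card]
  obtain ⟨j, rfl⟩ := Nat.exists_eq_add_of_le hk
  rw [Nat.add_sub_cancel_left] at *
  change Fintype.card K * _ ≤ _ at htotal
  change _ * Fintype.card K ≤ _
  nlinarith [Nat.mul_le_mul_left j hsize, Nat.mul_le_mul_left (2 + j + 2) hedges]

open SimpleGraph in
lemma SimpleGraph.Iso.ncard_oddComponents_eq {W : Type*} {G : SimpleGraph V} {H : SimpleGraph W}
    (φ : G ≃g H) : G.oddComponents.ncard = H.oddComponents.ncard := by
  rw [← Nat.card_coe_set_eq, ← Nat.card_coe_set_eq]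
  refine Nat.card_congr (φ.connectedComponentEquiv.subtypeEquiv fun c => ?_)
  have : c.supp.ncard = (φ.connectedComponentEquiv c).supp.ncard := by
    rw [← Nat.card_coe_set_eq, ← Nat.card_coe_set_eq]
    exact Nat.card_congr (ConnectedComponent.isoEquivSupp φ c)
  rw [Set.mem_ofPred_eq, Set.mem_ofPred_eq, this]

/-- Deleting vertices from the full subgraph amounts to inducing on the complement. -/
def SimpleGraph.deleteVertsTopIso (G : SimpleGraph V) (u : Set V) :
    ((⊤ : G.Subgraph).deleteVerts u).coe ≃g G.induce uᶜ where
  toEquiv := Equiv.subtypeEquivRight fun v => by simp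
  map_rel_iff' := by
    rintro ⟨a, ha⟩ ⟨b, hb⟩
    simp at ha hb
    simp [ha, hb]

/-- The join of `G` with a complete graph on `W`. -/
def SimpleGraph.joinComplete (G : SimpleGraph V) (W : Type*) : SimpleGraph (V ⊕ W) where
  Adj x y := x ≠ y ∧ ∀ a b, x = Sum.inl a → y = Sum.inl b → G.Adj a b
  symm := ⟨fun _ _ h => ⟨h.1.symm, fun a b ha hb => (h.2 b a hb ha).symm⟩⟩
  loopless := ⟨fun _ h => h.1 rfl⟩

/-- Deleting all the added vertices from the join leaves an induced subgraph of `G`. -/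
noncomputable def SimpleGraph.induceComplJoinCompleteIso (G : SimpleGraph V) {W : Type*}
    {u : Set (V ⊕ W)}
    (hu : ∀ i, Sum.inr i ∈ u) :
    G.induce (Sum.inl ⁻¹' u)ᶜ ≃g (G.joinComplete W).induce uᶜ where
  toEquiv := Equiv.ofBijective (fun v => ⟨Sum.inl v.1, v.2⟩) <| by
    refine ⟨fun a b h => Subtype.ext (by simpa using h), ?_⟩
    rintro ⟨a | i, h⟩
    · exact ⟨⟨a, h⟩, rfl⟩
    · exact absurd (hu i) h
  map_rel_iff' := by
    rintro ⟨a, ha⟩ ⟨b, hb⟩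
    simp only [joinComplete, comap_adj, Function.Embedding.subtype_apply]
    constructor
    · intro h
      exact h.2 a b rfl rfl
    · intro h
      refine ⟨fun hab => (show G.Adj a b from h).ne (Sum.inl_injective hab), ?_⟩
      rintro _ _ ⟨⟩ ⟨⟩
      exact h

open SimpleGraph in
/-- The existence half of the Tutte–Berge formula, in terms of the join with a complete graph. -/
lemma SimpleGraph.exists_isPerfectMatching_joinComplete [Finite V] (G : SimpleGraph V) (d : ℕ)
    (heven : Even (Nat.card V + d))
    (h : ∀ S : Set V, (G.induce Sᶜ).oddComponents.ncard ≤ S.ncard + d) :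
    ∃ M : (G.joinComplete (Fin d)).Subgraph, M.IsPerfectMatching := by
  rw [tutte]
  intro u hu
  rw [IsTutteViolator, (deleteVertsTopIso _ u).ncard_oddComponents_eq] at hu
  by_cases hall : ∀ i, Sum.inr i ∈ u
  · rw [← (G.induceComplJoinCompleteIso hall).ncard_oddComponents_eq] at hu
    have hcard : u.ncard = (Sum.inl ⁻¹' u : Set V).ncard + d := by
      have hunion : u = Sum.inl '' (Sum.inl ⁻¹' u) ∪ Set.range Sum.inr := by
        ext (a | i) <;> simp [hall]
      conv_lhs => rw [hunion]
      rw [Set.ncard_union_eq, Set.ncard_image_of_injective _ Sum.inl_injective,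
        ← Set.image_univ, Set.ncard_image_of_injective _ Sum.inr_injective, Set.ncard_univ,
        Nat.card_eq_fintype_card, Fintype.card_fin]
      rw [Set.disjoint_left]
      rintro _ ⟨a, -, rfl⟩ ⟨i, hi⟩
      cases hi
    have := h (Sum.inl ⁻¹' u)
    omega
  · push Not at hall
    obtain ⟨i, hi⟩ := hall
    have hpre : ((G.joinComplete (Fin d)).induce uᶜ).Preconnected := by
      have hto : ∀ x, ((G.joinComplete (Fin d)).induce uᶜ).Reachable x ⟨Sum.inr i, hi⟩ := by
        rintro ⟨x, hx⟩
        by_cases hxi : x = Sum.inr i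
        · subst hxi
          exact Reachable.refl _
        · refine Adj.reachable ⟨hxi, ?_⟩
          rintro a b - ⟨⟩
      exact fun x y => (hto x).trans (hto y).symm
    have hle : ((G.joinComplete (Fin d)).induce uᶜ).oddComponents.ncard ≤ 1 := by
      have := hpre.subsingleton_connectedComponent
      exact Set.ncard_le_one_of_subsingleton _
    have hu0 : u.ncard = 0 := by omega
    obtain rfl : u = ∅ := (Set.ncard_eq_zero (Set.toFinite u)).1 hu0
    have hodd : Odd ((G.joinComplete (Fin d)).induce ∅ᶜ).oddComponents.ncard := by
      rw [show ((G.joinComplete (Fin d)).induce ∅ᶜ).oddComponents.ncard = 1 by omega]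
      exact odd_one
    rw [odd_ncard_oddComponents, Nat.card_coe_set_eq, Set.compl_empty, Set.ncard_univ, Nat.card_sum,
      Nat.card_eq_fintype_card (α := Fin d), Fintype.card_fin] at hodd
    exact Nat.not_even_iff_odd.2 hodd heven

open SimpleGraph Finset in
/-- A perfect matching of the join with `d` universal vertices yields a small edge cover. -/
lemma SimpleGraph.exists_edgeCover_of_isPerfectMatching_joinComplete [Fintype V] (G : SimpleGraph V)
    (d : ℕ) (hiso : ∀ v, ∃ w, G.Adj v w) {M : (G.joinComplete (Fin d)).Subgraph}
    (hM : M.IsPerfectMatching) :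
    ∃ C : Set (Sym2 V), C ⊆ G.edgeSet ∧ (∀ v, ∃ e ∈ C, v ∈ e) ∧
      2 * C.ncard ≤ Fintype.card V + d := by
  choose f hf using hiso
  choose p hp hpu using fun x => hM.1 (hM.2 x)
  let H : SimpleGraph V :=
    { Adj := fun a b => M.Adj (Sum.inl a) (Sum.inl b)
      symm := ⟨fun a b h => h.symm⟩
      loopless := ⟨fun a h => G.irrefl ((M.adj_sub h).2 a a rfl rfl)⟩ }
  let B : Finset V := {v | ∃ i, p (Sum.inl v) = Sum.inr i}
  have hB : #B ≤ d := by
    have hinr : #(univ.image (Sum.inr : Fin d → V ⊕ Fin d)) = d := by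
      rw [card_image_of_injective _ Sum.inr_injective, card_univ, Fintype.card_fin]
    rw [← hinr]
    refine card_le_card_of_injOn (fun v => p (Sum.inl v)) (fun v hv => ?_) fun a _ b _ hab => ?_
    · obtain ⟨i, hi⟩ : ∃ i, p (Sum.inl v) = Sum.inr i := by simpa [B] using hv
      simp [hi]
    · have h2 := hp (Sum.inl b)
      rw [← show p (Sum.inl a) = p (Sum.inl b) from hab] at h2
      exact Sum.inl_injective (hM.1.eq_of_adj_right (hp (Sum.inl a)) h2)
  have hE : 2 * #H.edgeFinset + #B ≤ Fintype.card V := by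
    rw [← sum_degrees_eq_twice_card_edges, ← card_univ, card_eq_sum_ones, card_eq_sum_ones,
      ← sum_filter_add_sum_filter_not univ (· ∈ B), ← sum_filter_add_sum_filter_not univ (· ∈ B)]
    have h0 : ∑ v with v ∈ B, H.degree v = 0 := by
      refine sum_eq_zero fun v hv => ?_
      obtain ⟨i, hi⟩ : ∃ i, p (Sum.inl v) = Sum.inr i := by simpa [B] using hv
      rw [← card_neighborFinset_eq_degree, card_eq_zero]
      refine eq_empty_of_forall_notMem fun w hw => ?_
      have := hpu (Sum.inl v) (Sum.inl w) (by simpa [H] using hw)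
      rw [hi] at this
      cases this
    have h1 : ∑ v with v ∉ B, H.degree v ≤ ∑ v with v ∉ B, 1 := by
      refine sum_le_sum fun v _ => ?_
      rw [← card_neighborFinset_eq_degree, card_le_one]
      intro a ha b hb
      have h2 := hpu (Sum.inl v) (Sum.inl a) (by simpa [H] using ha)
      have h3 := hpu (Sum.inl v) (Sum.inl b) (by simpa [H] using hb)
      exact Sum.inl_injective (h2.trans h3.symm)
    have h4 : ∑ v with v ∈ B, 1 = ∑ v ∈ B, 1 := by simp
    omega
  refine ⟨↑(H.edgeFinset ∪ B.image fun v => s(v, f v)), ?_, ?_, ?_⟩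
  · intro e he
    rcases mem_union.1 (mem_coe.1 he) with he | he
    · induction e with
      | h a b =>
        have : M.Adj (Sum.inl a) (Sum.inl b) := by simpa [H] using he
        exact (M.adj_sub this).2 a b rfl rfl
    · obtain ⟨v, -, rfl⟩ := mem_image.1 he
      exact hf v
  · intro v
    rcases hpv : p (Sum.inl v) with w | i
    · refine ⟨s(v, w), ?_, Sym2.mem_mk_left v w⟩
      have := hp (Sum.inl v)
      rw [hpv] at this
      refine mem_coe.2 (mem_union_left _ ?_)
      simpa [H] using this
    · refine ⟨s(v, f v), ?_, Sym2.mem_mk_left _ _⟩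
      exact mem_coe.2 (mem_union_right _ (mem_image_of_mem _ (by simp [B, hpv])))
  · rw [Set.ncard_coe_finset]
    have h1 := card_union_le H.edgeFinset (B.image fun v => s(v, f v))
    have h2 : #(B.image fun v => s(v, f v)) ≤ #B := card_image_le
    omega

open SimpleGraph Finset in
/-- In a regular graph of positive degree, every edge cover bounds `es_Δ` from above. -/
lemma SimpleGraph.IsRegularOfDegree.esDelta_le_ncard [Fintype V] [Nonempty V] {G : SimpleGraph V}
    {k : ℕ} (hreg : G.IsRegularOfDegree k) {C : Set (Sym2 V)} (hC : C ⊆ G.edgeSet)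
    (hcov : ∀ v, ∃ e ∈ C, v ∈ e) : G.esDelta ≤ C.ncard := by
  obtain ⟨D, hDC, hD⟩ :=
    (Set.toFinite {D : Set (Sym2 V) | ∀ v, ∃ e ∈ D, v ∈ e}).exists_le_minimal hcov
  refine le_trans (Nat.sInf_le ⟨D, ⟨hDC.trans hC, ?_⟩, rfl⟩) (Set.ncard_le_ncard hDC)
  have hmax : G.maxDegree = k := hreg.maxDegree_eq
  have hle : ∀ v, (G.deleteEdges D).degree v ≤ k - 1 := by
    intro v
    obtain ⟨e, he, hve⟩ := hD.prop v
    obtain ⟨w, rfl⟩ := hve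
    have hlt : (G.deleteEdges D).degree v < G.degree v := by
      rw [← card_neighborFinset_eq_degree, ← card_neighborFinset_eq_degree]
      refine card_lt_card (ssubset_iff_of_subset ?_ |>.2 ⟨w, ?_, ?_⟩)
      · intro x hx
        simp only [mem_neighborFinset, deleteEdges_adj] at hx ⊢
        exact hx.1
      · simpa using hC (hDC he)
      · simp [he]
    rw [hreg v] at hlt
    omega
  have hge : ∃ v, k - 1 ≤ (G.deleteEdges D).degree v := by
    obtain ⟨v₀⟩ := ‹Nonempty V›
    obtain ⟨e, he, -⟩ := hD.prop v₀
    have hnot : ¬ ∀ v, ∃ e' ∈ D \ {e}, v ∈ e' := fun h =>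
      (hD.le_of_le h Set.sdiff_subset he).2 rfl
    push Not at hnot
    obtain ⟨v, hv⟩ := hnot
    refine ⟨v, ?_⟩
    have honly : ∀ e' ∈ D, v ∈ e' → e' = e := by
      intro e' he' hve'
      by_contra hne
      exact hv e' ⟨he', hne⟩ hve'
    obtain ⟨e', he', w, rfl⟩ := hD.prop v
    have hsub : (G.neighborFinset v).erase w ⊆ (G.deleteEdges D).neighborFinset v := by
      intro x hx
      rw [mem_erase, mem_neighborFinset] at hx
      rw [mem_neighborFinset, deleteEdges_adj]
      refine ⟨hx.2, fun hxD => hx.1 ?_⟩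
      have h1 := honly _ hxD (Sym2.mem_mk_left v x)
      have h2 := honly _ he' (Sym2.mem_mk_left v w)
      exact Sym2.congr_right.1 (h1.trans h2.symm)
    have h3 := pred_card_le_card_erase (s := G.neighborFinset v) (a := w)
    have h4 := card_le_card hsub
    rw [card_neighborFinset_eq_degree, hreg v] at h3
    rw [card_neighborFinset_eq_degree] at h4
    omega
  rw [hmax]
  refine le_antisymm (maxDegree_le_of_forall_degree_le _ _ hle) ?_
  obtain ⟨v, hv⟩ := hge
  exact hv.trans (degree_le_maxDegree _ v)

open SimpleGraph in
/-- The deficiency bound for connected regular graphs of even degree, phrased with edge covers: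
twice a smallest edge cover exceeds the order by some `d` that is at most one or small. -/
lemma SimpleGraph.IsRegularOfDegree.exists_edgeCover_le [Fintype V] {G : SimpleGraph V} {k : ℕ}
    (hk : 2 ≤ k) (hke : Even k) (hreg : G.IsRegularOfDegree k) (hconn : G.Connected) :
    ∃ (C : Set (Sym2 V)) (d : ℕ), C ⊆ G.edgeSet ∧ (∀ v, ∃ e ∈ C, v ∈ e) ∧
      2 * C.ncard ≤ Fintype.card V + d ∧
      (d ≤ 1 ∨ (k ^ 2 + k + 2) * d ≤ (k - 2) * Fintype.card V) := by
  obtain ⟨S, hS⟩ := Finite.exists_max fun S : Set V =>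
    ((G.induce Sᶜ).oddComponents.ncard : ℤ) - S.ncard
  have h0 := hS ∅
  rw [Set.ncard_empty] at h0
  obtain ⟨d, hd⟩ : ∃ d, (G.induce Sᶜ).oddComponents.ncard = S.ncard + d :=
    Nat.exists_eq_add_of_le (by omega)
  have hparity : Even (Nat.card V + d) := by
    have h1 := odd_ncard_oddComponents (G.induce Sᶜ)
    rw [Nat.card_coe_set_eq, hd] at h1
    have h2 := Set.ncard_add_ncard_compl S
    rw [← h2]
    simp only [Nat.even_add, ← Nat.not_even_iff_odd] at h1 ⊢
    tauto
  obtain ⟨M, hM⟩ := G.exists_isPerfectMatching_joinComplete d hparity fun T => by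
    have := hS T
    omega
  have hiso : ∀ v, ∃ w, G.Adj v w := fun v =>
    (G.degree_pos_iff_exists_adj v).1 (by rw [hreg v]; omega)
  obtain ⟨C, hCG, hcov, hcard⟩ :=
    G.exists_edgeCover_of_isPerfectMatching_joinComplete d hiso hM
  refine ⟨C, d, hCG, hcov, hcard, ?_⟩
  rcases S.eq_empty_or_nonempty with rfl | hne
  · left
    have hpre : (G.induce ∅ᶜ).Preconnected := by
      rw [Set.compl_empty]
      exact (induceUnivIso G).preconnected_iff.2 hconn.preconnected
    have := hpre.subsingleton_connectedComponent
    have h1 : (G.induce ∅ᶜ).oddComponents.ncard ≤ 1 := Set.ncard_le_one_of_subsingleton _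
    omega
  · right
    have h1 := hreg.card_connectedComponent_induce_compl_le hk hke hconn
      (S := S.toFinset) (by simpa using hne)
    rw [Set.coe_toFinset, ← Set.ncard_eq_toFinset_card'] at h1
    have h2 : S.ncard + d ≤ Nat.card (G.induce Sᶜ).ConnectedComponent := by
      rw [← hd, ← Set.ncard_univ]
      exact Set.ncard_le_ncard (Set.subset_univ _)
    nlinarith [Nat.mul_le_mul_left (k ^ 2 + k + 2) h2]

/-- For a connected `k`-regular graph with `k ≥ 2` even:
`es_Δ(G) ≤ max{(1 − (k²+4)/(2(k²+k+2)))·n, (n+1)/2}`. -/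
theorem stmt_9 [Fintype V] (G : SimpleGraph V) (k : ℕ) (hk : 2 ≤ k) (hke : Even k)
    (hreg : G.IsRegularOfDegree k) (hconn : G.Connected) :
    (G.esDelta : ℝ) ≤
      max ((1 - ((k : ℝ) ^ 2 + 4) / (2 * ((k : ℝ) ^ 2 + k + 2))) * Fintype.card V)
        (((Fintype.card V : ℝ) + 1) / 2) := by
  have := hconn.nonempty
  obtain ⟨C, d, hCG, hcov, hcard, hd⟩ := hreg.exists_edgeCover_le hk hke hconn
  have hle : 2 * G.esDelta ≤ Fintype.card V + d :=
    (Nat.mul_le_mul_left 2 (hreg.esDelta_le_ncard hCG hcov)).trans hcard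
  have hle' : 2 * (G.esDelta : ℝ) ≤ Fintype.card V + d := by exact_mod_cast hle
  rcases hd with hd | hd
  · refine le_max_of_le_right ?_
    have : (d : ℝ) ≤ 1 := by exact_mod_cast hd
    linarith
  · refine le_max_of_le_left ?_
    have hd' : ((k : ℝ) ^ 2 + k + 2) * d ≤ ((k : ℝ) - 2) * Fintype.card V := by
      have : (((k ^ 2 + k + 2) * d : ℕ) : ℝ) ≤ (((k - 2) * Fintype.card V : ℕ) : ℝ) := by
        exact_mod_cast hd
      push_cast [Nat.cast_sub hk] at this
      exact this
    have hpos : (0 : ℝ) < (k : ℝ) ^ 2 + k + 2 := by positivity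
    have hrw : (1 - ((k : ℝ) ^ 2 + 4) / (2 * ((k : ℝ) ^ 2 + k + 2))) * Fintype.card V =
        (((k : ℝ) ^ 2 + k + 2) * Fintype.card V + ((k : ℝ) - 2) * Fintype.card V) /
          (2 * ((k : ℝ) ^ 2 + k + 2)) := by
      field_simp
      ring
    rw [hrw, le_div_iff₀ (by positivity)]
    nlinarith [mul_le_mul_of_nonneg_left hle' hpos.le]
end
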